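/- Let A be an AW*-algebra of type II₁, let M be a maximal abelian subalgebra of A, and let n be a positive integer. Then M contains n pairwise orthogonal projections, pairwise equivalent in A, whose sum is 1. -/

import Mathlib

universe u

section Defs

variable {R : Type u} [Ring R] [StarRing R]

/-- An element is a projection if it is self-adjoint and idempotent. -/
def IsProjection (p : R) : Prop := star p = p ∧ p * p = p

/-- Order on projections: `e ≤ f` iff `e = ef`. -/
def ProjLE (e f : R) : Prop := e * f = e

/-- Murray–von Neumann equivalence of projections. -/
def ProjEquiv (e f : R) : Prop := ∃ v : R, star v * v = e ∧ v * star v = f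

/-- `e ≼ f` : `e` is equivalent to a subprojection of `f`. -/
def ProjSubEquiv (e f : R) : Prop :=
  ∃ e' : R, IsProjection e' ∧ ProjLE e' f ∧ ProjEquiv e e'

/-- `e ≺ f` : `e ≼ f` but `e` is not equivalent to `f` (with the convention `0 ≺ 0`). -/
def ProjLT (e f : R) : Prop :=
  (ProjSubEquiv e f ∧ ¬ ProjEquiv e f) ∨ (e = 0 ∧ f = 0)

/-- A central projection. -/
def IsCentralProj (z : R) : Prop := IsProjection z ∧ ∀ a : R, z * a = a * z

/-- `c` is the central cover of `e`: the least central projection above `e`. -/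
def IsCentralCover (e c : R) : Prop :=
  IsCentralProj c ∧ ProjLE e c ∧
    ∀ z : R, IsCentralProj z → ProjLE e z → ProjLE c z

/-- A projection `e` is finite if `e ∼ f ≤ e` implies `f = e`. -/
def ProjFinite (e : R) : Prop :=
  ∀ f : R, IsProjection f → ProjEquiv e f → ProjLE f e → f = e

/-- A nonzero projection is properly infinite if `ze` is infinite
for every central projection `z` with `ze ≠ 0`. -/
def ProperlyInfinite (e : R) : Prop :=
  IsProjection e ∧ e ≠ 0 ∧
    ∀ z : R, IsCentralProj z → z * e ≠ 0 → ¬ ProjFinite (z * e)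

/-- A pairwise orthogonal family of elements. -/
def PairwiseOrthogonal {ι : Type*} (p : ι → R) : Prop :=
  ∀ i j, i ≠ j → p i * p j = 0

/-- `s` is the supremum of the family `p` in the projection order. For an
orthogonal family, this is the sum `Σ pᵢ`. -/
def IsSupProj {ι : Type*} (p : ι → R) (s : R) : Prop :=
  IsProjection s ∧ (∀ i, ProjLE (p i) s) ∧
    ∀ t : R, IsProjection t → (∀ i, ProjLE (p i) t) → ProjLE s t

/-- The family `p` belongs to `Γ(e)`: an orthogonal family of projections,
each equivalent to `e`, with sum (supremum) `e`. -/
def InGamma (e : R) {ι : Type u} (p : ι → R) : Prop :=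
  (∀ i, IsProjection (p i)) ∧ PairwiseOrthogonal p ∧
    (∀ i, ProjEquiv (p i) e) ∧ IsSupProj p e

open Classical in
/-- The dimension `d(e)` of a properly infinite projection: the least cardinal
strictly greater than the cardinality of the index set of every family in
`Γ(e)`, with the convention `d(0) = 0`. -/
noncomputable def projDim (e : R) : Cardinal.{u} :=
  if e = 0 then 0
  else sSup {c : Cardinal.{u} |
    ∃ (ι : Type u) (p : ι → R), InGamma e p ∧ c = Order.succ (Cardinal.mk ι)}

/-- A properly infinite projection `e` is equidimensional if `d(ze) = d(e)`
for every central projection `z` with `ze ≠ 0` (equivalently, for every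
nonzero central projection `z ≤ c(e)`). -/
def Equidimensional (e : R) : Prop :=
  ProperlyInfinite e ∧
    ∀ z : R, IsCentralProj z → z * e ≠ 0 → projDim (z * e) = projDim e

/-- An abelian projection: the corner `eRe` is commutative. -/
def IsAbelianProj (e : R) : Prop :=
  IsProjection e ∧ ∀ a b : R, (e * a * e) * (e * b * e) = (e * b * e) * (e * a * e)

/-- `j` is the join `e ∨ f` in the projection lattice. -/
def IsJoinProj (e f j : R) : Prop :=
  IsProjection j ∧ ProjLE e j ∧ ProjLE f j ∧
    ∀ t : R, IsProjection t → ProjLE e t → ProjLE f t → ProjLE j t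

end Defs

/-- The AW*-condition: the right annihilator of any subset is generated by a
projection: `{a | ∀ s ∈ S, s a = 0} = pR`. -/
def IsAWStarRing (R : Type*) [Ring R] [StarRing R] : Prop :=
  ∀ S : Set R, ∃ p : R, IsProjection p ∧
    {a : R | ∀ s ∈ S, s * a = 0} = {a : R | ∃ b : R, a = p * b}

/-- A maximal abelian (*-sub)algebra. -/
def IsMaximalAbelian {A : Type*} [Ring A] [StarRing A] [Algebra ℂ A] [StarModule ℂ A]
    (M : StarSubalgebra ℂ A) : Prop :=
  (∀ x ∈ M, ∀ y ∈ M, x * y = y * x) ∧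
    ∀ N : StarSubalgebra ℂ A, (∀ x ∈ N, ∀ y ∈ N, x * y = y * x) → M ≤ N → M = N


section Helpers

set_option linter.unusedSimpArgs false
set_option linter.unusedVariables false

variable {A : Type*} [CStarAlgebra A]

theorem ra {a b c : A} (h : a * b = c) (x : A) : a * (b * x) = c * x := by
  rw [← mul_assoc, h]

theorem IsProjection.one_sub {p : A} (h : IsProjection p) : IsProjection (1 - p) := by
  refine ⟨by simp [h.1], ?_⟩
  simp [mul_sub, sub_mul, h.2]

theorem IsProjection.sub {p q : A} (hp : IsProjection p) (hq : IsProjection q)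
    (h : q * p = q) : IsProjection (p - q) := by
  have h' : p * q = q := by
    have := congrArg star h
    simpa [hp.1, hq.1] using this
  refine ⟨by simp [hp.1, hq.1], ?_⟩
  simp [mul_sub, sub_mul, hp.2, hq.2, h, h']

theorem IsProjection.add {p q : A} (hp : IsProjection p) (hq : IsProjection q)
    (h : q * p = 0) : IsProjection (p + q) := by
  have h' : p * q = 0 := by
    have := congrArg star h
    simpa [hp.1, hq.1] using this
  refine ⟨by simp [hp.1, hq.1], ?_⟩
  simp [mul_add, add_mul, hp.2, hq.2, h, h']

theorem IsProjection.mul {p q : A} (hp : IsProjection p) (hq : IsProjection q)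
    (h : q * p = p * q) : IsProjection (p * q) := by
  refine ⟨by simp [hp.1, hq.1, h], ?_⟩
  simp only [mul_assoc, ra h, hq.2, ra hp.2]

/-- swap sides of a product equation by taking adjoints -/
theorem IsProjection.le_symm {p q : A} (hp : IsProjection p) (hq : IsProjection q)
    (h : q * p = q) : p * q = q := by
  have := congrArg star h
  simpa [hp.1, hq.1] using this

theorem IsProjection.zero_symm {p q : A} (hp : IsProjection p) (hq : IsProjection q)
    (h : q * p = 0) : p * q = 0 := by
  have := congrArg star h
  simpa [hp.1, hq.1] using this

theorem pi_right {v e : A} (he : IsProjection e) (h : star v * v = e) : v * e = v := by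
  have h1 : star (v - v * e) * (v - v * e) = 0 := by
    simp only [star_sub, star_mul, he.1, mul_sub, sub_mul, mul_assoc, h, ra h, he.2]
    simp [he.2]
  have h2 := CStarRing.star_mul_self_eq_zero_iff (v - v * e) |>.1 h1
  exact (sub_eq_zero.1 h2).symm

theorem pi_self {v e : A} (he : IsProjection e) (h : star v * v = e) :
    v * star v * v = v := by
  rw [mul_assoc, h, pi_right he h]

theorem pi_self' {v e : A} (he : IsProjection e) (h : star v * v = e) :
    star v * (v * star v) = star v := by
  have := congrArg star (pi_self he h)
  simpa [mul_assoc] using this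

theorem proj_of_pi {v : A} (h : v * star v * v = v) : IsProjection (star v * v) := by
  refine ⟨by simp, ?_⟩
  rw [mul_assoc, ← mul_assoc v, h]

theorem proj_of_pi' {v : A} (h : v * star v * v = v) : IsProjection (v * star v) := by
  refine ⟨by simp, ?_⟩
  rw [← mul_assoc, h]

theorem equiv_proj {v e f : A} (he : IsProjection e) (h : star v * v = e) (h' : v * star v = f) :
    IsProjection f := h' ▸ proj_of_pi' (pi_self he h)

theorem ProjEquiv.proj {e f : A} (he : IsProjection e) (h : ProjEquiv e f) : IsProjection f := by
  obtain ⟨v, h1, h2⟩ := h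
  exact equiv_proj he h1 h2

theorem ProjEquiv.symm {e f : A} (h : ProjEquiv e f) : ProjEquiv f e := by
  obtain ⟨v, h1, h2⟩ := h
  exact ⟨star v, by simpa using h2, by simpa using h1⟩

theorem ProjEquiv.refl {e : A} (he : IsProjection e) : ProjEquiv e e :=
  ⟨e, by rw [he.1, he.2], by rw [he.1, he.2]⟩

theorem ProjEquiv.trans {e f g : A} (he : IsProjection e) (h : ProjEquiv e f)
    (h' : ProjEquiv f g) : ProjEquiv e g := by
  have hf := h.proj he
  obtain ⟨v, h1, h2⟩ := h
  obtain ⟨w, h3, h4⟩ := h'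
  have h5 := pi_right hf h3
  have h6 := pi_self he h1
  refine ⟨w * v, ?_, ?_⟩
  · rw [star_mul, mul_assoc, ra h3, ← h2, h6, h1]
  · rw [star_mul, mul_assoc, ra h2, ← mul_assoc, h5, h4]

theorem ProjEquiv.add {e f e' f' : A} (he : IsProjection e) (hf : IsProjection f)
    (he' : IsProjection e') (hf' : IsProjection f')
    (h : ProjEquiv e e') (h' : ProjEquiv f f') (h0 : e * f = 0) (h0' : e' * f' = 0) :
    ProjEquiv (e + f) (e' + f') := by
  obtain ⟨v, h1, h2⟩ := h
  obtain ⟨w, h3, h4⟩ := h'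
  have a1 := pi_right he h1
  have a2 := pi_right hf h3
  have a3 : star v * e' = star v := by rw [← h2]; exact pi_self' he h1
  have a4 : star w * f' = star w := by rw [← h4]; exact pi_self' hf h3
  have b1 : star v * w = 0 := by
    have : f' * w = w := by simpa [hf'.1] using congrArg star a4
    rw [← a3, ← this, mul_assoc, ra h0']; simp
  have b2 : star w * v = 0 := by simpa using congrArg star b1
  have b3 : v * star w = 0 := by
    have : f * star w = star w := by simpa [hf.1] using congrArg star a2
    rw [← a1, ← this, mul_assoc, ra h0]; simp
  have b4 : w * star v = 0 := by simpa using congrArg star b3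
  exact ⟨v + w, by simp [mul_add, add_mul, b1, b2, h1, h3], by simp [mul_add, add_mul, b3, b4, h2, h4]⟩

/-- restriction of an equivalence by a subprojection -/
theorem equiv_restrict {v e f x : A} (he : IsProjection e) (h : star v * v = e)
    (h' : v * star v = f) (hx : IsProjection x) (hxe : x * e = x) :
    star (v * x) * (v * x) = x ∧ (v * x) * star (v * x) = v * x * star v ∧
      IsProjection (v * x * star v) ∧ (v * x * star v) * f = v * x * star v := by
  have hex := he.le_symm hx hxe
  have h1 : star (v * x) * (v * x) = x := by
    simp only [star_mul, mul_assoc, ra h, hex, hx.1, hx.2]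
  have h2 : (v * x) * star (v * x) = v * x * star v := by
    simp only [star_mul, mul_assoc, hx.1, ra hx.2]
  refine ⟨h1, h2, equiv_proj hx h1 h2, ?_⟩
  rw [← h', mul_assoc, pi_self' he h]

theorem ProjSubEquiv.intro {e f v : A} (he : IsProjection e) (hf : IsProjection f)
    (h : star v * v = e) (h' : f * v = v) : ProjSubEquiv e f := by
  refine ⟨v * star v, equiv_proj he h rfl, ?_, v, h, rfl⟩
  have h4 : star v * f = star v := by simpa [hf.1] using congrArg star h'
  rw [ProjLE, mul_assoc, h4]

theorem ProjSubEquiv.elim {e f : A} (hf : IsProjection f)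
    (h : ProjSubEquiv e f) : ∃ v, star v * v = e ∧ f * v = v ∧ v * e = v := by
  obtain ⟨e', h1, h2, v, h3, h4⟩ := h
  have hs : star (star v) * star v = e' := by simpa using h4
  have k1 : star v * e' = star v := pi_right h1 hs
  have k : e' * v = v := by simpa [h1.1] using congrArg star k1
  refine ⟨v, h3, ?_, ?_⟩
  · rw [← k, ra (hf.le_symm h1 h2)]
  · rw [← h3, ← mul_assoc, h4, k]

theorem ProjSubEquiv.trans {e f g : A} (he : IsProjection e) (hf : IsProjection f)
    (hg : IsProjection g) (h : ProjSubEquiv e f) (h' : ProjSubEquiv f g) : ProjSubEquiv e g := by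
  obtain ⟨v, h1, h2, -⟩ := h.elim hf
  obtain ⟨w, h3, h4, -⟩ := h'.elim hg
  refine .intro (v := w * v) he hg ?_ (ra h4 _)
  rw [star_mul, mul_assoc, ra h3, h2, h1]

theorem ProjEquiv.sub {e f : A} (he : IsProjection e) (h : ProjEquiv e f) : ProjSubEquiv e f :=
  ⟨f, h.proj he, (h.proj he).2, h⟩

theorem ProjSubEquiv.of_le {e f : A} (he : IsProjection e) (h : e * f = e) : ProjSubEquiv e f :=
  ⟨e, he, h, .refl he⟩

/-! ### Supports -/

/-- `g` is the support projection of the family `w`. -/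
def Sp {ι : Type*} (w : ι → A) (g : A) : Prop :=
  IsProjection g ∧ ∀ y, g * y = 0 ↔ ∀ i, w i * y = 0

theorem exists_sp (hAW : IsAWStarRing A) {ι : Type*} (w : ι → A) : ∃ g, Sp w g := by
  obtain ⟨p, hp, h⟩ := hAW (Set.range w)
  refine ⟨1 - p, hp.one_sub, fun y => ?_⟩
  have h1 := Set.ext_iff.1 h y
  simp only [Set.mem_ofPred_eq, Set.forall_mem_range] at h1
  rw [h1, sub_mul, one_mul, sub_eq_zero]
  constructor
  · intro h; exact ⟨y, h⟩
  · rintro ⟨b, rfl⟩; rw [← mul_assoc, hp.2]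

section Sp
variable {ι : Type*} {w : ι → A} {g : A}

theorem Sp.mul_right (h : Sp w g) (i : ι) : w i * g = w i := by
  have := (h.2 (1 - g)).1 (by simp [mul_sub, h.1.2]) i
  rw [mul_sub, mul_one, sub_eq_zero] at this
  exact this.symm

theorem Sp.mul_left (h : Sp w g) {i : ι} (hi : star (w i) = w i) : g * w i = w i := by
  simpa [hi, h.1.1] using congrArg star (h.mul_right i)

theorem Sp.zero_left (h : Sp w g) (hw : ∀ i, star (w i) = w i) {y : A}
    (hy : ∀ i, y * w i = 0) : y * g = 0 := by
  have := (h.2 (star y)).2 (fun i => by simpa [hw i] using congrArg star (hy i))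
  simpa [h.1.1] using congrArg star this

theorem Sp.ext_left (h : Sp w g) (hw : ∀ i, star (w i) = w i) {x y : A}
    (hy : ∀ i, x * w i = y * w i) : x * g = y * g := by
  have := h.zero_left hw (y := x - y) (fun i => by rw [sub_mul, hy, sub_self])
  rwa [sub_mul, sub_eq_zero] at this

theorem Sp.comm (h : Sp w g) {c : A} (h1 : ∀ i, w i * c = c * w i)
    (h2 : ∀ i, w i * star c = star c * w i) : g * c = c * g := by
  have key : ∀ c : A, (∀ i, w i * c = c * w i) → g * c = g * c * g := by
    intro c hc
    have : g * (c * (1 - g)) = 0 := (h.2 _).2 (fun i => by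
      rw [ra (hc i), mul_assoc, mul_sub, mul_one, h.mul_right, sub_self, mul_zero])
    rw [mul_sub, mul_sub, mul_one, sub_eq_zero, ← mul_assoc] at this
    exact this
  have k1 := key c h1
  have k2 := congrArg star (key (star c) h2)
  simp only [star_mul, star_star, h.1.1] at k2
  rw [k1, k2, mul_assoc]

theorem Sp.eq {g' : A} (h : Sp w g) (h' : Sp w g') : g = g' := by
  have a : g * (1 - g') = 0 := (h.2 _).2 ((h'.2 _).1 (by simp [mul_sub, h'.1.2]))
  have b : g' * (1 - g) = 0 := (h'.2 _).2 ((h.2 _).1 (by simp [mul_sub, h.1.2]))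
  rw [mul_sub, mul_one, sub_eq_zero] at a b
  have c := h.1.le_symm h'.1 b.symm
  rw [a, c]

end Sp

/-- orthogonal family of partial isometries -/
def OF {ι : Type*} (w : ι → A) : Prop :=
  (∀ i, w i * star (w i) * w i = w i) ∧
    ∀ i j, i ≠ j → star (w i) * w j = 0 ∧ w i * star (w j) = 0

theorem add_orth (hAW : IsAWStarRing A) {ι : Type*} {w : ι → A} (hw : OF w)
    (h0 : ∀ i j, w i * w j = 0) {e f : A} (he : Sp (fun i => star (w i) * w i) e)
    (hf : Sp (fun i => w i * star (w i)) f) : ProjEquiv e f := by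
  obtain ⟨g, hg⟩ := exists_sp hAW
    (fun i => star (w i) * w i + w i + star (w i) + w i * star (w i))
  have h0' : ∀ i j, star (w i) * star (w j) = 0 := fun i j => by
    simpa using congrArg star (h0 j i)
  have ew : ∀ i, w i * (star (w i) * w i) = w i := fun i => by rw [← mul_assoc, hw.1]
  have we : ∀ i, star (w i) * (w i * star (w i)) = star (w i) := fun i => by
    simpa [mul_assoc] using congrArg star (hw.1 i)
  have sG : ∀ i, star (star (w i) * w i + w i + star (w i) + w i * star (w i)) =
      star (w i) * w i + w i + star (w i) + w i * star (w i) := fun i => by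
    simp; abel
  have A1 : ∀ i, g * (star (w i) * w i - w i) = 0 := fun i => (hg.2 _).2 fun j => by
    by_cases hij : j = i
    · subst hij
      simp only [add_mul, mul_sub, mul_assoc, ew, h0, ra (h0 _ _), ra (h0' _ _)]
      simp
    · obtain ⟨q1, q2⟩ := hw.2 j i hij
      simp only [add_mul, mul_sub, mul_assoc, h0, ra (h0 _ _), ra (h0' _ _), ra q1, ra q2, q1, q2]
      simp
  have A2 : ∀ i, g * (w i * star (w i) - star (w i)) = 0 := fun i => (hg.2 _).2 fun j => by
    by_cases hij : j = i
    · subst hij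
      simp only [add_mul, mul_sub, mul_assoc, we, h0, ra (h0 _ _), h0', ra (h0' _ _)]
      simp
    · obtain ⟨q1, q2⟩ := hw.2 j i hij
      simp only [add_mul, mul_sub, mul_assoc, h0, ra (h0 _ _), h0', ra (h0' _ _), ra q1, ra q2, q1, q2]
      simp
  have B1 : ∀ i, g * (star (w i) * w i + w i) = star (w i) * w i + w i := fun i => by
    have := hg.mul_left (i := i) (sG i)
    have h2 := congrArg (· * (star (w i) * w i)) this
    simp only [add_mul, mul_assoc, ew, h0, ra (h0 _ _), ra (h0' _ _)] at h2
    simpa using h2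
  have B2 : ∀ i, g * (w i * star (w i) + star (w i)) = w i * star (w i) + star (w i) := fun i => by
    have := hg.mul_left (i := i) (sG i)
    have h2 := congrArg (· * (w i * star (w i))) this
    simp only [add_mul, mul_assoc, we, h0, ra (h0 _ _), ra (h0' _ _)] at h2
    simpa [add_comm] using h2
  have C1 : ∀ i, (2 * g) * (star (w i) * w i) = star (w i) * w i + w i := fun i => by
    have a := A1 i; have b := B1 i
    rw [mul_sub, sub_eq_zero] at a
    rw [mul_add, ← a] at b
    rw [mul_assoc, two_mul, b]
  have C2 : ∀ i, (2 * g) * (w i * star (w i)) = w i * star (w i) + star (w i) := fun i => by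
    have a := A2 i; have b := B2 i
    rw [mul_sub, sub_eq_zero] at a
    rw [mul_add, ← a] at b
    rw [mul_assoc, two_mul, b]
  have se : ∀ i, star (star (w i) * w i) = star (w i) * w i := fun i => by simp
  have sf : ∀ i, star (w i * star (w i)) = w i * star (w i) := fun i => by simp
  have fe : ∀ i, f * (star (w i) * w i) = 0 := fun i => (hf.2 _).2 fun j => by
    rw [mul_assoc, ra (h0' _ _)]; simp
  have ef : ∀ i, e * (w i * star (w i)) = 0 := fun i => (he.2 _).2 fun j => by
    rw [mul_assoc, ra (h0 _ _)]; simp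
  have fw : ∀ i, f * w i = w i := fun i => by
    have := hf.mul_left (i := i) (sf i)
    have h2 := congrArg (· * w i) this
    simpa only [mul_assoc, ew] using h2
  have ews : ∀ i, e * star (w i) = star (w i) := fun i => by
    have := he.mul_left (i := i) (se i)
    have h2 := congrArg (· * star (w i)) this
    simpa only [mul_assoc, we] using h2
  have ee : ∀ i, e * (star (w i) * w i) = star (w i) * w i := fun i => he.mul_left (se i)
  have ff : ∀ i, f * (w i * star (w i)) = w i * star (w i) := fun i => hf.mul_left (sf i)
  have st : star (f * (2 * g) * e) = e * (2 * g) * f := by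
    simp [he.1.1, hf.1.1, hg.1.1, mul_assoc, two_mul, add_mul, mul_add]
  have D1 : ∀ i, f * (2 * g) * e * (star (w i) * w i) = w i := fun i => by
    rw [mul_assoc, ee, mul_assoc, C1, mul_add, fe, fw, zero_add]
  have D2 : ∀ i, e * (2 * g) * f * (w i * star (w i)) = star (w i) := fun i => by
    rw [mul_assoc, ff, mul_assoc, C2, mul_add, ef, ews, zero_add]
  refine ⟨f * (2 * g) * e, ?_, ?_⟩
  · rw [st]
    have : (e * (2 * g) * f * (f * (2 * g) * e)) * e = 1 * e := he.ext_left se fun i => by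
      rw [mul_assoc, D1]
      conv_lhs => rw [← ew i, ← mul_assoc (w i), ← mul_assoc, D2]
      simp
    rw [one_mul, mul_assoc, mul_assoc _ e e, he.1.2] at this
    exact this
  · rw [st]
    have : (f * (2 * g) * e * (e * (2 * g) * f)) * f = 1 * f := hf.ext_left sf fun i => by
      rw [mul_assoc, D2]
      conv_lhs => rw [← we i, ← mul_assoc (star (w i)), ← mul_assoc, D1]
      simp
    rw [one_mul, mul_assoc, mul_assoc _ f f, hf.1.2] at this
    exact this

end Helpers

section Analysis

set_option linter.unusedSimpArgs false
set_option linter.unusedVariables false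

variable {A : Type*} [CStarAlgebra A]

theorem exists_pi (hAW : IsAWStarRing A) {x : A} (hx : x ≠ 0) :
    ∃ v : A, v ≠ 0 ∧ v * star v * v = v ∧ (∀ e, e * x = x → e * v = v) ∧
      (∀ f, x * f = x → v * f = v) := by
  have ha : IsSelfAdjoint (star x * x) := IsSelfAdjoint.star_mul_self x
  have ha0 : star x * x ≠ 0 := fun h => hx ((CStarRing.star_mul_self_eq_zero_iff x).1 h)
  obtain ⟨t, ht, ht0⟩ : ∃ t ∈ spectrum ℝ (star x * x), t ≠ 0 := by
    by_contra! hcon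
    apply ha0
    rw [← cfc_id ℝ (star x * x)]
    rw [← cfc_const_zero ℝ (star x * x)]
    exact cfc_congr fun t ht => hcon t ht
  have htpos : 0 < t := lt_of_le_of_ne (spectrum_star_mul_self_nonneg t ht) ht0.symm
  set a := star x * x with hadef
  set ε := t / 2 with hε
  have hεpos : 0 < ε := by positivity
  have hmax : ∀ s : ℝ, max s ε ≠ 0 := fun s => (lt_of_lt_of_le hεpos (le_max_right _ _)).ne'
  have hmax' : ∀ s : ℝ, √(max s ε) ≠ 0 := fun s =>
    (Real.sqrt_pos.2 (lt_of_lt_of_le hεpos (le_max_right _ _))).ne'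
  have c1 : Continuous fun s : ℝ => (√(max s ε))⁻¹ := Continuous.inv₀ (by fun_prop) hmax'
  have c2 : Continuous fun s : ℝ => max (s - ε) 0 := by fun_prop
  have c3 : Continuous fun s : ℝ => max (s - ε) 0 * (max s ε)⁻¹ :=
    c2.mul (Continuous.inv₀ (by fun_prop) hmax)
  have c11 : Continuous fun s : ℝ => (√(max s ε))⁻¹ * (√(max s ε))⁻¹ := c1.mul c1
  have c12 : Continuous fun s : ℝ => (√(max s ε))⁻¹ * (√(max s ε))⁻¹ * s := c11.mul continuous_id
  set d := cfc (fun s : ℝ => (√(max s ε))⁻¹) a with hd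
  set b := cfc (fun s : ℝ => max (s - ε) 0) a with hb
  have hdsa : star d = d := IsSelfAdjoint.cfc
  have hbsa : star b = b := IsSelfAdjoint.cfc
  have e1 : b = cfc (fun s : ℝ => max (s - ε) 0 * (max s ε)⁻¹) a * a := by
    conv_rhs => rw [← cfc_id' ℝ a]
    rw [hb, cfc_id' ℝ a, ← cfc_id' ℝ a]
    rw [cfc_id' ℝ a]
    conv_rhs => 
      arg 2
      rw [← cfc_id' ℝ a]
    rw [← cfc_mul _ _ a c3.continuousOn (by fun_prop)]
    apply cfc_congr
    intro s hs
    simp only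
    rcases le_or_gt ε s with h | h
    · have : s ≠ 0 := (lt_of_lt_of_le hεpos h).ne'
      rw [max_eq_left h]; field_simp
    · rw [max_eq_right (by linarith)]; simp
  have e2 : d * d * a * b = b := by
    have h1 : a = cfc (fun s : ℝ => s) a := (cfc_id' ℝ a).symm
    have : d * d * cfc (fun s : ℝ => s) a * b = b := by
      rw [hd, hb, ← cfc_mul _ _ a c1.continuousOn c1.continuousOn,
        ← cfc_mul _ _ a c11.continuousOn (by fun_prop),
        ← cfc_mul _ _ a c12.continuousOn (by fun_prop)]
      apply cfc_congr
      intro s hs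
      simp only
      rcases le_or_gt ε s with h | h
      · have : s ≠ 0 := (lt_of_lt_of_le hεpos h).ne'
        rw [max_eq_left h, ← mul_inv, Real.mul_self_sqrt (by linarith), inv_mul_cancel₀ this, one_mul]
      · rw [max_eq_right (by linarith : s - ε ≤ 0)]; simp
    rwa [← h1] at this
  have e3 : b ≠ 0 := by
    intro h
    rw [hb, ← cfc_const_zero ℝ a, cfc_eq_cfc_iff_eqOn ha c2.continuousOn (by fun_prop)] at h
    have h' : max (t - ε) 0 = 0 := h ht
    have : t - ε = t / 2 := by rw [hε]; ring
    rw [this, max_eq_left (by linarith)] at h'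
    linarith
  obtain ⟨g, hg⟩ := exists_sp hAW (fun _ : Unit => b)
  have bd : b * d = d * b := ((Commute.refl a).cfc_real _).symm.cfc_real _ |>.symm
  have ba : b * a = a * b := (Commute.refl a).cfc_real _
  have gd : g * d = d * g := hg.comm (fun _ => bd) (fun _ => by rw [hdsa]; exact bd)
  have ga : g * a = a * g := hg.comm (fun _ => ba) (fun _ => by rw [ha.star_eq]; exact ba)
  have gf : ∀ f, x * f = x → g * f = g := fun f hf => by
    have : g * (1 - f) = 0 := (hg.2 _).2 fun _ => by
      rw [e1, mul_assoc, hadef, mul_assoc, mul_sub, hf]; simp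
    rw [mul_sub, mul_one, sub_eq_zero] at this; exact this.symm
  have e4 : d * d * a * g = g := by
    have := hg.ext_left (fun _ => hbsa) (x := d * d * a) (y := 1) (fun _ => by rw [e2, one_mul])
    rwa [one_mul] at this
  have e5 : star (x * d * g) * (x * d * g) = g := by
    calc star (x * d * g) * (x * d * g) = g * (d * (a * (d * g))) := by
          simp only [star_mul, hg.1.1, hdsa, hadef, mul_assoc]
      _ = d * d * a * g := by
          have h1 : a * d = d * a := ((Commute.refl a).cfc_real _).symm
          simp only [mul_assoc, ra gd, ra ga, ra h1, hg.1.2]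
      _ = g := e4
  refine ⟨x * d * g, ?_, ?_, ?_, ?_⟩
  · intro h
    rw [h, mul_zero] at e5
    apply e3
    have := hg.mul_right ()
    rw [← this, ← e5, mul_zero]
  · exact pi_self hg.1 e5
  · intro e he
    rw [mul_assoc, ra he]
  · intro f hf
    rw [mul_assoc, gf f hf]

/-- comparison of two arbitrary projections up to orthogonal remainders -/
theorem two_proj (hAW : IsAWStarRing A) {e f : A} (he : IsProjection e) (hf : IsProjection f) :
    ∃ r, IsProjection r ∧ r * e = e * r ∧ r * f = f * r ∧ ProjEquiv (e * r) (f * r) ∧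
      f * e * (1 - r) = 0 := by
  let _ := CStarAlgebra.spectralOrder A
  let _ := CStarAlgebra.spectralOrderedRing A
  set t := e + f - 1 with ht
  have tsa : IsSelfAdjoint t := by
    rw [IsSelfAdjoint, ht]; simp [he.1, hf.1]
  have te : t * e = f * e := by simp [ht, sub_mul, add_mul, he.2]
  have ft : f * t = f * e := by simp [ht, mul_sub, mul_add, hf.2]
  have et : e * t = e * f := by simp [ht, mul_sub, mul_add, he.2]
  have tf : t * f = e * f := by simp [ht, sub_mul, add_mul, hf.2]
  have c1 : Commute (star t * t) e := by
    rw [tsa.star_eq]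
    show t * t * e = e * (t * t)
    rw [mul_assoc, te, ← ft, ra tf, ra et]
  have c2 : Commute (star t * t) f := by
    rw [tsa.star_eq]
    show t * t * f = f * (t * t)
    rw [mul_assoc, tf, ← et, ra te, ra ft]
  set k := CFC.abs t with hk
  have ke : k * e = e * k := Commute.cfcₙ_nnreal c1 _
  have kf : k * f = f * k := Commute.cfcₙ_nnreal c2 _
  have ks : star k = k := (IsSelfAdjoint.of_nonneg (CFC.abs_nonneg t)).star_eq
  have hsum : t⁺ + t⁻ = k := CFC.posPart_add_negPart t
  have hdiff : t⁺ - t⁻ = t := CFC.posPart_sub_negPart t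
  have hpn : t⁺ * t⁻ = 0 := CFC.posPart_mul_negPart t
  have hnp : t⁻ * t⁺ = 0 := CFC.negPart_mul_posPart t
  have ps : star t⁺ = t⁺ := (IsSelfAdjoint.of_nonneg (CFC.posPart_nonneg t)).star_eq
  have ns : star t⁻ = t⁻ := (IsSelfAdjoint.of_nonneg (CFC.negPart_nonneg t)).star_eq
  obtain ⟨p, hp⟩ := exists_sp hAW (fun _ : Unit => t⁺)
  obtain ⟨q, hq⟩ := exists_sp hAW (fun _ : Unit => t⁻)
  have p1 : p * t⁺ = t⁺ := hp.mul_left (i := ()) ps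
  have p1' : t⁺ * p = t⁺ := hp.mul_right ()
  have p2 : p * t⁻ = 0 := (hp.2 _).2 fun _ => hpn
  have p2' : t⁻ * p = 0 := by simpa [hp.1.1, ns] using congrArg star p2
  have q1 : q * t⁻ = t⁻ := hq.mul_left (i := ()) ns
  have q1' : t⁻ * q = t⁻ := hq.mul_right ()
  have q2 : q * t⁺ = 0 := (hq.2 _).2 fun _ => hnp
  have q2' : t⁺ * q = 0 := by simpa [hq.1.1, ps] using congrArg star q2
  have qp : q * p = 0 := (hq.2 _).2 fun _ => p2'
  have pq : p * q = 0 := (hp.2 _).2 fun _ => q2'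
  have hr : Sp (fun _ : Unit => k) (p + q) := by
    refine ⟨hp.1.add hq.1 qp, fun y => ⟨fun h _ => ?_, fun h => ?_⟩⟩
    · have : k * (p + q) = k := by
        rw [← hsum]; simp [mul_add, add_mul, p1', p2', q1', q2']
      rw [← this, mul_assoc, h, mul_zero]
    · have h := h ()
      have h1 : p * (k * y) = t⁺ * y := by
        rw [← hsum, add_mul, mul_add, ra p1, ra p2]; simp
      have h2 : q * (k * y) = t⁻ * y := by
        rw [← hsum, add_mul, mul_add, ra q1, ra q2]; simp
      rw [h, mul_zero] at h1 h2
      rw [add_mul, (hp.2 y).2 fun _ => h1.symm, (hq.2 y).2 fun _ => h2.symm, add_zero]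
  have sk : (p - q) * k = t := by
    rw [← hsum]; simp [mul_add, sub_mul, p1, p2, q1, q2, ← sub_eq_add_neg, hdiff]
  have tr : t * (p + q) = t := by
    conv_lhs => rw [← sk, mul_assoc, hr.mul_right ()]
    exact sk
  have ss : (p - q) * (p - q) = p + q := by
    simp [mul_sub, sub_mul, hp.1.2, hq.1.2, pq, qp]
  have sr : (p - q) * (p + q) = p - q := by
    simp only [mul_add, sub_mul, hp.1.2, hq.1.2, pq, qp]; abel
  have sstar : star (p - q) = p - q := by simp [hp.1.1, hq.1.1]
  have re : (p + q) * e = e * (p + q) := hr.comm (fun _ => ke) (fun _ => by rw [he.1]; exact ke)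
  have rf : (p + q) * f = f * (p + q) := hr.comm (fun _ => kf) (fun _ => by rw [hf.1]; exact kf)
  have se : (p - q) * e = f * (p - q) := by
    have h1 : (p - q) * e * (p + q) = f * (p - q) * (p + q) := hr.ext_left (fun _ => ks) fun _ => by
      rw [mul_assoc, ← ke, ra sk, te, mul_assoc, sk, ft]
    rw [mul_assoc, ← re, ra sr, mul_assoc, sr] at h1
    exact h1
  refine ⟨p + q, hr.1, re, rf, ⟨(p - q) * e, ?_, ?_⟩, ?_⟩
  · rw [star_mul, sstar, he.1, mul_assoc, ra ss, re, ra he.2]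
  · rw [star_mul, sstar, he.1, mul_assoc, ra he.2, ra se, mul_assoc, ss]
  · rw [← te, mul_assoc, mul_sub, mul_one, ← re, mul_sub, ra tr, sub_self]

/-- a commutes with `b` if `b` commutes with the spectral projections of `a`. -/
theorem comm_of_proj (hAW : IsAWStarRing A) {a b : A} (ha : IsSelfAdjoint a)
    (hb : ∀ q, IsProjection q → (∀ c, a * c = c * a → q * c = c * q) → q * b = b * q) :
    a * b = b * a := by
  let _ := CStarAlgebra.spectralOrder A
  let _ := CStarAlgebra.spectralOrderedRing A
  have key : ∀ n : ℕ, ∀ x : A, 0 ≤ x → x ≤ 1 → (∀ c, a * c = c * a → x * c = c * x) →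
      ‖x * b - b * x‖ ≤ 2 * ‖b‖ * (1 / 2) ^ n := by
    intro n
    induction n with
    | zero =>
      intro x h0 h1 _
      have hx : ‖x‖ ≤ 1 := (CStarAlgebra.norm_le_one_iff_of_nonneg x h0).2 h1
      have k1 : ‖x * b‖ ≤ ‖b‖ := (norm_mul_le _ _).trans (by nlinarith [norm_nonneg b])
      have k2 : ‖b * x‖ ≤ ‖b‖ := (norm_mul_le _ _).trans (by nlinarith [norm_nonneg b])
      calc _ ≤ ‖x * b‖ + ‖b * x‖ := norm_sub_le _ _
        _ ≤ _ := by simp; linarith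
    | succ n ih =>
      intro x h0 h1 hxc
      set t := x + x - 1 with ht
      have tsa : IsSelfAdjoint t := by
        have := (IsSelfAdjoint.of_nonneg h0).star_eq
        rw [IsSelfAdjoint, ht]; simp [this]
      have hdiff : t⁺ - t⁻ = t := CFC.posPart_sub_negPart t
      have hpn : t⁺ * t⁻ = 0 := CFC.posPart_mul_negPart t
      have p0 := CFC.posPart_nonneg t
      have n0 := CFC.negPart_nonneg t
      have ps : star t⁺ = t⁺ := (IsSelfAdjoint.of_nonneg p0).star_eq
      have ns : star t⁻ = t⁻ := (IsSelfAdjoint.of_nonneg n0).star_eq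
      obtain ⟨q, hq⟩ := exists_sp hAW (fun _ : Unit => t⁺)
      have q1 : q * t⁺ = t⁺ := hq.mul_left (i := ()) ps
      have q2 : q * t⁻ = 0 := (hq.2 _).2 fun _ => hpn
      have q1' : t⁺ * q = t⁺ := hq.mul_right ()
      have q2' : t⁻ * q = 0 := by simpa [hq.1.1, ns] using congrArg star q2
      have qt : q * t = t⁺ := by
        calc q * t = q * (t⁺ - t⁻) := by rw [hdiff]
          _ = t⁺ := by rw [mul_sub, q1, q2, sub_zero]
      have tq : t * q = t⁺ := by
        calc t * q = (t⁺ - t⁻) * q := by rw [hdiff]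
          _ = t⁺ := by rw [sub_mul, q1', q2', sub_zero]
      have tc : ∀ c, a * c = c * a → t * c = c * t := fun c hc => by
        have := hxc c hc
        simp [ht, sub_mul, add_mul, mul_sub, mul_add, this]
      have qc : ∀ c, a * c = c * a → q * c = c * q := fun c hc => by
        have hc' : a * star c = star c * a := by
          simpa [ha.star_eq] using (congrArg star hc).symm
        exact hq.comm (fun _ => Commute.cfcₙ_real (tc c hc) _)
          (fun _ => Commute.cfcₙ_real (tc _ hc') _)
      have qb := hb q hq.1 qc
      have y0 : 0 ≤ x + x - q := by
        have h2 : 0 ≤ (1 - q) * (x + x) * (1 - q) :=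
          IsSelfAdjoint.conjugate_nonneg (add_nonneg h0 h0) hq.1.one_sub.1
        have h3 : x + x - q = (1 - q) * (x + x) * (1 - q) + t⁺ := by
          have : x + x = 1 + t := by rw [ht]; abel
          rw [this]
          simp only [sub_mul, mul_sub, mul_add, add_mul, one_mul, mul_one, hq.1.2, qt, tq, q1']
          abel
        rw [h3]; exact add_nonneg h2 p0
      have y1 : x + x - q ≤ 1 := by
        have h2 : 0 ≤ q * ((1 - x) + (1 - x)) * q :=
          IsSelfAdjoint.conjugate_nonneg
            (add_nonneg (sub_nonneg.2 h1) (sub_nonneg.2 h1)) hq.1.1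
        have h3 : 1 - (x + x - q) = q * ((1 - x) + (1 - x)) * q + t⁻ := by
          have h4 : (1 - x) + (1 - x) = 1 - t := by rw [ht]; abel
          have h5 : x + x = 1 + t := by rw [ht]; abel
          rw [h4, h5]
          simp only [sub_mul, mul_sub, one_mul, mul_one, hq.1.2, qt, q1']
          generalize t⁺ = u at *
          generalize t⁻ = w at *
          rw [← hdiff]
          abel
        rw [← sub_nonneg, h3]; exact add_nonneg h2 n0
      have := ih (x + x - q) y0 y1 (fun c hc => by
        simp [sub_mul, mul_sub, add_mul, mul_add, hxc c hc, qc c hc])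
      have h6 : (x + x - q) * b - b * (x + x - q) = (2 : ℝ) • (x * b - b * x) := by
        simp only [sub_mul, mul_sub, add_mul, mul_add, qb, two_smul]
        abel
      rw [h6, norm_smul, Real.norm_ofNat] at this
      rw [pow_succ]; linarith
  have key2 : ∀ x : A, 0 ≤ x → x ≤ 1 → (∀ c, a * c = c * a → x * c = c * x) →
      x * b = b * x := by
    intro x h0 h1 hx
    have hl : Filter.Tendsto (fun n : ℕ => 2 * ‖b‖ * (1 / 2 : ℝ) ^ n) Filter.atTop (nhds 0) := by
      simpa using (tendsto_pow_atTop_nhds_zero_of_lt_one (r := (1 / 2 : ℝ))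
        (by norm_num) (by norm_num)).const_mul (2 * ‖b‖)
    have := ge_of_tendsto' hl (fun n => key n x h0 h1 hx)
    exact sub_eq_zero.1 (norm_le_zero_iff.1 this)
  set N := ‖a‖ + 1 with hN
  have hNpos : 0 < N := by positivity
  have l1 : -(algebraMap ℝ A N) ≤ a := by
    refine le_trans (neg_le_neg ?_) (IsSelfAdjoint.neg_algebraMap_norm_le_self ha)
    exact algebraMap_mono A (by simp [hN])
  have l2 : a ≤ algebraMap ℝ A N :=
    le_trans (IsSelfAdjoint.le_algebraMap_norm_self ha) (algebraMap_mono A (by simp [hN]))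
  clear_value N
  have := key2 ((2 * N)⁻¹ • (a + algebraMap ℝ A N)) ?_ ?_ ?_
  · have hne : (2 * N)⁻¹ ≠ 0 := by positivity
    rw [smul_mul_assoc, mul_smul_comm] at this
    have := smul_right_injective A hne this
    rw [add_mul, mul_add, Algebra.commutes] at this
    exact add_right_cancel this
  · refine smul_nonneg (by positivity) ?_
    have := sub_nonneg.2 l1
    simpa using this
  · have : (2 * N)⁻¹ • (a + algebraMap ℝ A N) ≤ (2 * N)⁻¹ • (algebraMap ℝ A (2 * N)) := by
      refine smul_le_smul_of_nonneg_left ?_ (by positivity)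
      rw [two_mul, map_add]; exact add_le_add l2 le_rfl
    refine this.trans (le_of_eq ?_)
    rw [Algebra.algebraMap_eq_smul_one, smul_smul, inv_mul_cancel₀ (by positivity), one_smul]
  · intro c hc
    rw [smul_mul_assoc, mul_smul_comm, add_mul, mul_add c, hc, Algebra.commutes]

end Analysis

section Comparison

set_option linter.unusedSimpArgs false
set_option linter.unusedVariables false

variable {A : Type*} [CStarAlgebra A]

theorem nc (hAW : IsAWStarRing A) {r a b : A} (hr : IsProjection r) (ha : IsSelfAdjoint a)
    (har : a * r = r * a) (hb : r * b = b) (hb' : b * r = b) (hne : a * b ≠ b * a) :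
    ∃ q, IsProjection q ∧ (∀ c, a * c = c * a → q * c = c * q) ∧
      ∃ c, (q * r) * c * (r - q * r) ≠ 0 := by
  by_contra! H
  apply hne
  apply comm_of_proj hAW ha
  intro q hq hqc
  have qr := hqc r har
  have h1 := H q hq hqc b
  have h2 := H (1 - q) hq.one_sub (fun c hc => by simp [sub_mul, mul_sub, hqc c hc]) b
  have e1 : q * r * b * (r - q * r) = q * b - q * b * q := by
    rw [qr]; rw [← qr, mul_assoc q r b, hb, mul_sub, mul_assoc q b r, hb', qr, mul_assoc q b, ra hb', mul_assoc]
  have e2 : (1 - q) * r * b * (r - (1 - q) * r) = b * q - q * b * q := by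
    have : r - (1 - q) * r = r * q := by rw [sub_mul, qr]; simp
    rw [this, mul_assoc (1 - q), hb, mul_assoc, ra hb', sub_mul, one_mul, mul_assoc]
  rw [e1, sub_eq_zero] at h1
  rw [e2, sub_eq_zero] at h2
  rw [h1, h2]

theorem na (hAW : IsAWStarRing A) (hNA : ∀ e : A, IsAbelianProj e → e = 0) {r : A}
    (hr : IsProjection r) (h0 : r ≠ 0) :
    ∃ v, v ≠ 0 ∧ v * star v * v = v ∧ r * v = v ∧ v * r = v ∧ v * v = 0 := by
  obtain ⟨a, b, ha, hne⟩ : ∃ a b, IsSelfAdjoint a ∧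
      (r * a * r) * (r * b * r) ≠ (r * b * r) * (r * a * r) := by
    by_contra! H
    apply h0
    apply hNA r ⟨hr, fun a b => ?_⟩
    have hx := realPart_add_I_smul_imaginaryPart a
    rw [← hx]
    simp only [mul_add, add_mul, mul_smul_comm, smul_mul_assoc]
    rw [H _ b (realPart a).2, H _ b (imaginaryPart a).2]
  have ha' : IsSelfAdjoint (r * a * r) := by
    rw [IsSelfAdjoint]; simp [hr.1, ha.star_eq, mul_assoc]
  obtain ⟨q, hq, hqc, c, hc⟩ := nc hAW hr ha' (b := r * b * r)
    (by simp only [mul_assoc, hr.2, ra hr.2]) (by simp only [mul_assoc, hr.2, ra hr.2])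
    (by simp only [mul_assoc, hr.2, ra hr.2]) hne
  have qr : q * r = r * q := hqc r (by simp only [mul_assoc, hr.2, ra hr.2])
  have h1 : (q * r) * (q * r) = q * r := by
    rw [mul_assoc, ra qr.symm, mul_assoc, hr.2, ra hq.2]
  have h2 : r * (q * r) = q * r := by rw [ra qr.symm, mul_assoc, hr.2]
  have h3 : (q * r) * r = q * r := by rw [mul_assoc, hr.2]
  have h4 : (r - q * r) * (q * r) = 0 := by rw [sub_mul, h1, h2, sub_self]
  have h5 : (r - q * r) * (r - q * r) = r - q * r := by
    rw [mul_sub, h4, sub_mul, hr.2, h3, sub_zero]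
  have h6 : (r - q * r) * r = r - q * r := by rw [sub_mul, hr.2, h3]
  obtain ⟨v, v0, vv, hl, hrr⟩ := exists_pi hAW hc
  have k1 := hl (q * r) (by rw [mul_assoc (q * r), ra h1])
  have k2 := hrr (r - q * r) (by rw [mul_assoc, h5])
  refine ⟨v, v0, vv, hl r ?_, hrr r ?_, ?_⟩
  · rw [mul_assoc (q * r), ra h2]
  · rw [mul_assoc, h6]
  · calc v * v = (v * (r - q * r)) * ((q * r) * v) := by rw [k1, k2]
      _ = 0 := by rw [mul_assoc v, ra h4, zero_mul, mul_zero]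

theorem zorn_pw {α : Type*} (P : α → Prop) (Q : α → α → Prop) :
    ∃ W : Set α, (∀ w ∈ W, P w) ∧ (∀ w ∈ W, ∀ w' ∈ W, w ≠ w' → Q w w') ∧
      ∀ v, P v → (∀ w ∈ W, Q w v ∧ Q v w) → v ∈ W := by
  obtain ⟨W, hW⟩ := zorn_subset
    {W : Set α | (∀ w ∈ W, P w) ∧ (∀ w ∈ W, ∀ w' ∈ W, w ≠ w' → Q w w')} (by
      intro c hc hch
      refine ⟨⋃₀ c, ⟨?_, ?_⟩, fun s hs => Set.subset_sUnion_of_mem hs⟩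
      · rintro w ⟨s, hs, hw⟩
        exact (hc hs).1 w hw
      · rintro w ⟨s, hs, hw⟩ w' ⟨s', hs', hw'⟩ hne
        rcases hch.total hs hs' with h | h
        · exact (hc hs').2 w (h hw) w' hw' hne
        · exact (hc hs).2 w hw w' (h hw') hne)
  refine ⟨W, hW.1.1, hW.1.2, fun v hv hq => ?_⟩
  have := hW.2 (y := insert v W) ⟨?_, ?_⟩ (Set.subset_insert v W)
  · exact this (Set.mem_insert v W)
  · rintro w (rfl | hw)
    · exact hv
    · exact hW.1.1 w hw
  · rintro w (rfl | hw) w' (rfl | hw') hne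
    · exact absurd rfl hne
    · exact (hq w' hw').2
    · exact (hq w hw).1
    · exact hW.1.2 w hw w' hw' hne

theorem central_cover (hAW : IsAWStarRing A) {ι : Type*} (e : ι → A) :
    ∃ z, IsCentralProj z ∧ (∀ i, e i * z = e i) ∧ ∀ f, (∀ i a, e i * a * f = 0) → z * f = 0 := by
  obtain ⟨z, hz⟩ := exists_sp hAW (fun p : ι × A => e p.1 * p.2)
  have h1 : ∀ c, z * c * (1 - z) = 0 := fun c => by
    rw [mul_assoc]
    refine (hz.2 _).2 fun p => ?_
    have := hz.mul_right (p.1, p.2 * c)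
    simp only at this
    rw [← mul_assoc, mul_assoc (e p.1), mul_sub, this]; simp
  have h2 : ∀ c, z * c = z * c * z := fun c => by
    have := h1 c
    rwa [mul_sub, mul_one, sub_eq_zero] at this
  refine ⟨z, ⟨hz.1, fun c => ?_⟩, fun i => ?_, fun f hf => (hz.2 f).2 fun p => hf _ _⟩
  · have h3 := congrArg star (h2 (star c))
    simp only [star_mul, star_star, hz.1.1] at h3
    rw [h2 c, h3, mul_assoc]
  · simpa using hz.mul_right (i, 1)

theorem IsCentralProj.one_sub {z : A} (h : IsCentralProj z) : IsCentralProj (1 - z) :=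
  ⟨h.1.one_sub, fun a => by simp [sub_mul, mul_sub, h.2 a]⟩

theorem IsCentralProj.mul {z e : A} (h : IsCentralProj z) (he : IsProjection e) :
    IsProjection (z * e) := he.mul h.1 (h.2 e) |> fun H => by rw [h.2 e]; exact H

theorem ProjEquiv.central {z e f : A} (hz : IsCentralProj z) (h : ProjEquiv e f) :
    ProjEquiv (z * e) (z * f) := by
  obtain ⟨v, h1, h2⟩ := h
  refine ⟨z * v, ?_, ?_⟩
  · rw [star_mul, hz.1.1, mul_assoc, ra hz.1.2, hz.2, ← mul_assoc, h1, ← hz.2]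
  · rw [star_mul, hz.1.1, ← hz.2, mul_assoc, ra (hz.2 v).symm, mul_assoc, h2, ra hz.1.2]

theorem ProjSubEquiv.add {e f e' f' : A} (he : IsProjection e) (hf : IsProjection f)
    (he' : IsProjection e') (hf' : IsProjection f')
    (h : ProjSubEquiv e e') (h' : ProjSubEquiv f f') (h0 : e * f = 0) (h0' : e' * f' = 0) :
    ProjSubEquiv (e + f) (e' + f') := by
  obtain ⟨v, v1, v2, v3⟩ := h.elim he'
  obtain ⟨w, w1, w2, w3⟩ := h'.elim hf'
  have a1 : star v * w = 0 := by
    rw [← v2, ← w2, star_mul, he'.1, mul_assoc, ra h0']; simp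
  have a2 : star w * v = 0 := by simpa using congrArg star a1
  have h1' := hf'.zero_symm he' h0'
  have h1 := hf.zero_symm he h0
  refine ProjSubEquiv.intro (v := v + w) (he.add hf ?_) (he'.add hf' ?_) ?_ ?_
  · first | exact h0 | exact h1
  · first | exact h0' | exact h1'
  · simp [add_mul, mul_add, a1, a2, v1, w1]
  · have b1 : e' * w = 0 := by rw [← w2, ra h0', zero_mul]
    have b2 : f' * v = 0 := by rw [← v2, ra h1', zero_mul]
    simp [add_mul, mul_add, b1, b2, v2, w2]

theorem OF_of {W : Set A} (h1 : ∀ w ∈ W, w * star w * w = w)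
    (h2 : ∀ w ∈ W, ∀ w' ∈ W, w ≠ w' → star w * w' = 0 ∧ w * star w' = 0) :
    OF (fun w : W => (w : A)) :=
  ⟨fun w => h1 w w.2, fun i j hij => h2 i i.2 j j.2 (fun h => hij (Subtype.ext h))⟩

theorem zorn_pi (hAW : IsAWStarRing A) {e f : A} (he : IsProjection e) (hf : IsProjection f)
    (P : A → Prop) :
    ∃ (W : Set A) (e' f' : A), (∀ w ∈ W, P w ∧ f * w = w ∧ w * e = w) ∧
      OF (fun w : W => (w : A)) ∧
      Sp (fun w : W => star (w : A) * w) e' ∧ Sp (fun w : W => (w : A) * star (w : A)) f' ∧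
      e' * e = e' ∧ f' * f = f' ∧
      ∀ v, v * star v * v = v → P v → (f - f') * v = v → v * (e - e') = v → v = 0 := by
  obtain ⟨W, hP, hQ, hmax⟩ := zorn_pw
    (fun w : A => w * star w * w = w ∧ P w ∧ f * w = w ∧ w * e = w)
    (fun w w' => star w * w' = 0 ∧ w * star w' = 0)
  have hOF := OF_of (fun w hw => (hP w hw).1) hQ
  obtain ⟨e', he'⟩ := exists_sp hAW (fun w : W => star (w : A) * w)
  obtain ⟨f', hf'⟩ := exists_sp hAW (fun w : W => (w : A) * star (w : A))
  have l1 : e' * e = e' := by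
    have : e' * (1 - e) = 0 := (he'.2 _).2 fun w => by
      rw [mul_assoc, mul_sub, (hP w w.2).2.2.2]; simp
    rw [mul_sub, mul_one, sub_eq_zero] at this; exact this.symm
  have l2 : f' * f = f' := by
    have : f' * (1 - f) = 0 := (hf'.2 _).2 fun w => by
      have := congrArg star (hP w w.2).2.2.1
      rw [star_mul, hf.1] at this
      rw [mul_assoc, mul_sub, this]; simp
    rw [mul_sub, mul_one, sub_eq_zero] at this; exact this.symm
  have m1 := he.le_symm he'.1 l1
  have m2 := hf.le_symm hf'.1 l2
  refine ⟨W, e', f', fun w hw => (hP w hw).2, hOF, he', hf', l1, l2, fun v hv hPv v1 v2 => ?_⟩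
  have we : ∀ w ∈ W, w * (e - e') = 0 := fun w hw => by
    have h1 := he'.mul_right ⟨w, hw⟩
    simp only at h1
    have : w * e' = w := by
      nth_rewrite 1 [← (hP w hw).1]; rw [mul_assoc w, mul_assoc w, h1, ← mul_assoc, (hP w hw).1]
    rw [mul_sub, this, (hP w hw).2.2.2, sub_self]
  have wf : ∀ w ∈ W, (f - f') * w = 0 := fun w hw => by
    have h1 := hf'.mul_left (i := ⟨w, hw⟩) (by simp)
    simp only at h1
    have : f' * w = w := by
      nth_rewrite 1 [← (hP w hw).1]; rw [← mul_assoc, h1, (hP w hw).1]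
    rw [sub_mul, this, (hP w hw).2.2.1, sub_self]
  have se : star (e - e') = e - e' := by simp [he.1, he'.1.1]
  have sf : star (f - f') = f - f' := by simp [hf.1, hf'.1.1]
  have o1 : ∀ w ∈ W, star w * v = 0 := fun w hw => by
    have := congrArg star (wf w hw)
    rw [star_mul, sf, star_zero] at this
    rw [← v1, ra this, zero_mul]
  have o2 : ∀ w ∈ W, w * star v = 0 := fun w hw => by
    rw [← v2, star_mul, se, ra (we w hw), zero_mul]
  have hvW : v ∈ W := hmax v ⟨hv, hPv, ?_, ?_⟩ fun w hw => ⟨⟨o1 w hw, o2 w hw⟩, ?_, ?_⟩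
  · have := o1 v hvW
    exact (CStarRing.star_mul_self_eq_zero_iff v).1 this
  · rw [← v1, ← mul_assoc, mul_sub, hf.2, m2]
  · rw [← v2, mul_assoc, sub_mul, he.2, l1]
  · simpa using congrArg star (o1 w hw)
  · simpa using congrArg star (o2 w hw)

theorem gc_orth (hAW : IsAWStarRing A) {e f : A} (he : IsProjection e) (hf : IsProjection f)
    (hef : e * f = 0) :
    ∃ z, IsCentralProj z ∧ ProjSubEquiv (z * e) (z * f) ∧
      ProjSubEquiv ((1 - z) * f) ((1 - z) * e) := by
  obtain ⟨W, e', f', hW, hOF, he', hf', l1, l2, hmax⟩ := zorn_pi hAW he hf (fun _ => True)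
  have heq : ProjEquiv e' f' := add_orth hAW hOF (fun w w' => by
    rw [← (hW w w.2).2.2, ← (hW w' w'.2).2.1, mul_assoc, ra hef]; simp) he' hf'
  have m1 := he.le_symm he'.1 l1
  have m2 := hf.le_symm hf'.1 l2
  have pe := he.sub he'.1 l1
  have pf := hf.sub hf'.1 l2
  have h0 : ∀ a, (f - f') * a * (e - e') = 0 := by
    intro a
    by_contra hne
    obtain ⟨v, v0, vv, hl, hr⟩ := exists_pi hAW hne
    exact v0 (hmax v vv trivial (hl _ (by simp only [mul_assoc, ra pf.2]))
      (hr _ (by simp only [mul_assoc, pe.2])))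
  obtain ⟨z, hz, z1, z2⟩ := central_cover hAW (fun _ : Unit => f - f')
  have z3 := z2 (e - e') fun _ => h0
  have z1 := z1 ()
  have k1 : z * e = z * e' := by rwa [mul_sub, sub_eq_zero] at z3
  have k2 : (1 - z) * f = (1 - z) * f' := by
    rw [← sub_eq_zero, ← mul_sub, sub_mul, hz.2, z1]; simp
  have hz' := hz.one_sub
  refine ⟨z, hz, ?_, ?_⟩
  · rw [k1]
    refine ((heq.central hz).sub (hz.mul he'.1)).trans (hz.mul he'.1) (hz.mul hf'.1) (hz.mul hf) ?_
    refine ProjSubEquiv.of_le (hz.mul hf'.1) ?_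
    rw [mul_assoc, ra (hz.2 f').symm, mul_assoc, l2, ra hz.1.2]
  · rw [k2]
    refine ((heq.symm.central hz').sub (hz'.mul hf'.1)).trans (hz'.mul hf'.1) (hz'.mul he'.1)
      (hz'.mul he) ?_
    refine ProjSubEquiv.of_le (hz'.mul he'.1) ?_
    rw [mul_assoc, ra (hz'.2 e').symm, mul_assoc, l1, ra hz'.1.2]

theorem gc (hAW : IsAWStarRing A) {e f : A} (he : IsProjection e) (hf : IsProjection f) :
    ∃ z, IsCentralProj z ∧ ProjSubEquiv (z * e) (z * f) ∧
      ProjSubEquiv ((1 - z) * f) ((1 - z) * e) := by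
  obtain ⟨r, hr, re, rf, heq, h0⟩ := two_proj hAW he hf
  have per : IsProjection (e * r) := hr.mul he re.symm |> fun H => by first | exact H | (rw [← re]; exact H)
  have pfr : IsProjection (f * r) := hr.mul hf rf.symm |> fun H => by first | exact H | (rw [← rf]; exact H)
  have le1 : (e * r) * e = e * r := by rw [mul_assoc, re, ra he.2]
  have lf1 : (f * r) * f = f * r := by rw [mul_assoc, rf, ra hf.2]
  have pe := he.sub per le1
  have pf := hf.sub pfr lf1
  have oe : (e * r) * (e - e * r) = 0 := by rw [mul_sub, le1, per.2, sub_self]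
  have of : (f * r) * (f - f * r) = 0 := by rw [mul_sub, lf1, pfr.2, sub_self]
  have o : (f - f * r) * (e - e * r) = 0 := by
    have : (1 - r) * (e * (1 - r)) = e * (1 - r) := by
      simp only [mul_sub, sub_mul, one_mul, mul_one, mul_assoc, re, ra re, hr.2]; simp
    calc (f - f * r) * (e - e * r) = f * ((1 - r) * (e * (1 - r))) := by
          simp only [mul_sub, sub_mul, one_mul, mul_one, mul_assoc]
      _ = 0 := by rw [this, ← mul_assoc, h0]
  obtain ⟨z, hz, z1, z2⟩ := gc_orth hAW pe pf (pe.zero_symm pf o)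
  have cz : ∀ {z x y : A}, IsCentralProj z → x * y = 0 → (z * x) * (z * y) = 0 := by
    intro z x y hz h
    rw [mul_assoc, ra (hz.2 x).symm, mul_assoc, h]; simp
  have hz' := hz.one_sub
  have s1 : ∀ z : A, z * e = z * (e * r) + z * (e - e * r) := fun z => by rw [← mul_add]; simp
  have s2 : ∀ z : A, z * f = z * (f * r) + z * (f - f * r) := fun z => by rw [← mul_add]; simp
  refine ⟨z, hz, ?_, ?_⟩
  · rw [s1, s2]
    exact ProjSubEquiv.add (hz.mul per) (hz.mul pe) (hz.mul pfr) (hz.mul pf)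
      ((heq.central hz).sub (hz.mul per)) z1 (cz hz oe) (cz hz of)
  · rw [s1, s2]
    exact ProjSubEquiv.add (hz'.mul pfr) (hz'.mul pf) (hz'.mul per) (hz'.mul pe)
      ((heq.symm.central hz').sub (hz'.mul pfr)) z2 (cz hz' of) (cz hz' oe)

theorem halve (hAW : IsAWStarRing A) (hNA : ∀ e : A, IsAbelianProj e → e = 0) {e : A}
    (he : IsProjection e) :
    ∃ s, s * star s * s = s ∧ star s * s + s * star s = e ∧ s * s = 0 := by
  obtain ⟨W, hP, hQ, hmax⟩ := zorn_pw
    (fun w : A => w * star w * w = w ∧ e * w = w ∧ w * e = w ∧ w * w = 0)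
    (fun w w' => (star w * w' = 0 ∧ w * star w' = 0) ∧ w * w' = 0)
  have hOF := OF_of (fun w hw => (hP w hw).1) (fun w hw w' hw' h => (hQ w hw w' hw' h).1)
  have h0 : ∀ w w' : W, (w : A) * w' = 0 := fun w w' => by
    by_cases h : w = w'
    · subst h; exact (hP w w.2).2.2.2
    · exact (hQ w w.2 w' w'.2 fun hh => h (Subtype.ext hh)).2
  obtain ⟨e', he'⟩ := exists_sp hAW (fun w : W => star (w : A) * w)
  obtain ⟨f', hf'⟩ := exists_sp hAW (fun w : W => (w : A) * star (w : A))
  obtain ⟨s, s1, s2⟩ : ProjEquiv e' f' := add_orth hAW hOF h0 he' hf'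
  have l1 : e' * e = e' := by
    have : e' * (1 - e) = 0 := (he'.2 _).2 fun w => by
      rw [mul_assoc, mul_sub, (hP w w.2).2.2.1]; simp
    rw [mul_sub, mul_one, sub_eq_zero] at this; exact this.symm
  have l2 : f' * e = f' := by
    have : f' * (1 - e) = 0 := (hf'.2 _).2 fun w => by
      have := congrArg star (hP w w.2).2.1
      rw [star_mul, he.1] at this
      rw [mul_assoc, mul_sub, this]; simp
    rw [mul_sub, mul_one, sub_eq_zero] at this; exact this.symm
  have ef : e' * f' = 0 := (he'.2 _).2 fun w => hf'.zero_left (fun w => by simp) fun w' => by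
    rw [mul_assoc, ra (h0 w w')]; simp
  have fe := hf'.1.zero_symm he'.1 ef
  have ss : s * s = 0 := by
    have : f' * s = s := by rw [← s2]; exact pi_self he'.1 s1
    rw [← this, ← pi_right he'.1 s1]; simp only [mul_assoc]; rw [ra ef]; simp
  refine ⟨s, pi_self he'.1 s1, ?_, ss⟩
  rw [s1, s2]
  by_contra hne
  have p1 : IsProjection (e' + f') := he'.1.add hf'.1 (by first | exact ef | exact fe)
  have p2 := he.sub p1 (by rw [add_mul, l1, l2])
  obtain ⟨v, v0, vv, v1, v2, v3⟩ := na hAW hNA p2 (fun h => hne (sub_eq_zero.1 h).symm)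
  have sr := p2.1
  have er : e * (e - (e' + f')) = e - (e' + f') := by
    rw [mul_sub, he.2, mul_add, he.le_symm he'.1 l1, he.le_symm hf'.1 l2]
  have re : (e - (e' + f')) * e = e - (e' + f') := by rw [sub_mul, he.2, add_mul, l1, l2]
  have we : ∀ w ∈ W, w * (e - (e' + f')) = 0 := fun w hw => by
    have h1 := he'.mul_right ⟨w, hw⟩
    simp only at h1
    have h2 : w * e' = w := by
      nth_rewrite 1 [← (hP w hw).1]; rw [mul_assoc w, mul_assoc w, h1, ← mul_assoc, (hP w hw).1]
    have h3 : w * f' = 0 := by rw [← h2, mul_assoc, ef, mul_zero]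
    rw [mul_sub, mul_add, h3, h2, (hP w hw).2.2.1, add_zero, sub_self]
  have wf : ∀ w ∈ W, (e - (e' + f')) * w = 0 := fun w hw => by
    have h1 := hf'.mul_left (i := ⟨w, hw⟩) (by simp)
    simp only at h1
    have h2 : f' * w = w := by
      nth_rewrite 1 [← (hP w hw).1]; rw [← mul_assoc, h1, (hP w hw).1]
    have h3 : e' * w = 0 := by rw [← h2, ra ef, zero_mul]
    rw [sub_mul, add_mul, h3, h2, (hP w hw).2.1, zero_add, sub_self]
  generalize e - (e' + f') = r at *
  have o1 : ∀ w ∈ W, star w * v = 0 := fun w hw => by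
    have := congrArg star (wf w hw)
    rw [star_mul, sr, star_zero] at this
    rw [← v1, ra this, zero_mul]
  have o2 : ∀ w ∈ W, w * star v = 0 := fun w hw => by
    rw [← v2, star_mul, sr, ra (we w hw), zero_mul]
  have hvW : v ∈ W := hmax v ⟨vv, ?_, ?_, v3⟩ fun w hw => ⟨⟨⟨o1 w hw, o2 w hw⟩, ?_⟩, ⟨?_, ?_⟩, ?_⟩
  · have := o1 v hvW
    exact v0 ((CStarRing.star_mul_self_eq_zero_iff v).1 this)
  · rw [← v1, ra er]
  · rw [← v2, mul_assoc, re]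
  · rw [← v1, ra (we w hw), zero_mul]
  · simpa using congrArg star (o1 w hw)
  · simpa using congrArg star (o2 w hw)
  · rw [← v2, mul_assoc, wf w hw, mul_zero]

end Comparison

section Additivity

set_option linter.unusedSimpArgs false
set_option linter.unusedVariables false

variable {A : Type*} [CStarAlgebra A]

theorem Sp.central {ι : Type*} {w : ι → A} {g z : A} (h : Sp w g) (hz : IsCentralProj z) :
    Sp (fun i => z * w i) (z * g) := by
  refine ⟨hz.mul h.1, fun y => ?_⟩
  have h1 : z * g * y = g * (z * y) := by rw [hz.2 g, mul_assoc]
  have h2 : ∀ i, z * w i * y = w i * (z * y) := fun i => by rw [hz.2 (w i), mul_assoc]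
  rw [h1, h.2]
  simp only [h2]

theorem add_half_aux (hAW : IsAWStarRing A) {ι : Type*} {u : ι → A} (hu : OF u) {E F F' z : A}
    (hE : Sp (fun i => star (u i) * u i) E) (hF : Sp (fun i => u i * star (u i)) F)
    (hFF : ProjEquiv F F') (h0 : F' * F = 0) (hz : IsCentralProj z)
    (hs : ProjSubEquiv (z * E) (z * F)) : ProjEquiv (z * E) (z * F) := by
  have hF' := hFF.proj hF.1
  have pE := hz.mul hE.1
  have hs' : ProjSubEquiv (z * E) (z * F') :=
    hs.trans pE (hz.mul hF.1) (hz.mul hF') ((hFF.central hz).sub (hz.mul hF.1))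
  obtain ⟨q, q1, q2, q3⟩ := hs'.elim (hz.mul hF')
  have uE : ∀ i, u i * E = u i := fun i => by
    have h1 := hE.mul_right i
    nth_rewrite 1 [← hu.1 i]; rw [mul_assoc (u i), mul_assoc (u i), h1, ← mul_assoc, hu.1 i]
  have Fu : ∀ i, F * u i = u i := fun i => by
    have h1 := hF.mul_left (i := i) (by simp)
    nth_rewrite 1 [← hu.1 i]; rw [← mul_assoc, h1, hu.1 i]
  have qs1 : star q * (z * F') = star q := by
    have := congrArg star q2
    rwa [star_mul, (hz.mul hF').1] at this
  have qs3 : (z * E) * star q = star q := by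
    have := congrArg star q3
    rwa [star_mul, pE.1] at this
  have qu : ∀ i, star q * u i = 0 := fun i => by
    rw [← qs1, ← Fu i]; simp only [mul_assoc]; rw [ra h0]; simp
  have qz : z * star q = star q := by
    rw [← qs3, mul_assoc, ra hz.1.2]
  have zq : q * z = q := by
    rw [← q3, mul_assoc, mul_assoc, ← hz.2, ra hz.1.2]
  have Eq : E * star q = star q := by
    rw [← qs3, mul_assoc, ra (hz.2 E).symm, mul_assoc, ra hE.1.2]
  have A1 : ∀ i, star (z * u i * star q) * (z * u i * star q) = q * (star (u i) * u i) * star q := by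
    intro i
    simp only [star_mul, star_star, hz.1.1, mul_assoc]
    rw [ra hz.1.2, ra (hz.2 _).symm, mul_assoc, ra (hz.2 _).symm, mul_assoc, ra (show z * q = q by rw [hz.2, zq])]
  have A2 : ∀ i, (z * u i * star q) * star (z * u i * star q) = z * (u i * star (u i)) := by
    intro i
    simp only [star_mul, star_star, hz.1.1, mul_assoc]
    rw [ra q1]; simp only [mul_assoc]
    rw [← hz.2, ra (hz.2 (u i)).symm, mul_assoc, ra hz.1.2, ra (hz.2 E).symm,
      mul_assoc, ra (hz.2 (u i)).symm, mul_assoc, ra hz.1.2, ra (uE i)]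
  have hOF : OF (fun i => z * u i * star q) := by
    refine ⟨fun i => ?_, fun i j hij => ⟨?_, ?_⟩⟩
    · rw [A2]
      simp only [mul_assoc]
      rw [ra (hz.2 (star (u i))).symm, mul_assoc, ra (hz.2 (u i)).symm, mul_assoc, ra hz.1.2]
      rw [ra (hu.1 i ▸ rfl : u i * (star (u i)) = u i * star (u i))]
      simp only [← mul_assoc]
      rw [mul_assoc z, mul_assoc z, hu.1 i]
    · simp only [star_mul, star_star, hz.1.1, mul_assoc]
      rw [ra hz.1.2, ra (hz.2 _).symm, mul_assoc, ra (hu.2 i j hij).1]; simp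
    · simp only [star_mul, star_star, hz.1.1, mul_assoc]
      rw [ra q1, ← hz.2, hz.2 E]; simp only [mul_assoc]
      rw [ra hz.1.2, ra (uE i), ra (hz.2 (u i)).symm, mul_assoc, (hu.2 i j hij).2]; simp
  have hS2 : Sp (fun i => (z * u i * star q) * star (z * u i * star q)) (z * F) := by
    simp only [A2]; exact hF.central hz
  have hS1 : Sp (fun i => star (z * u i * star q) * (z * u i * star q)) (q * star q) := by
    simp only [A1]
    refine ⟨equiv_proj pE q1 rfl, fun y => ⟨fun h i => ?_, fun h => ?_⟩⟩
    · have : star q * y = 0 := by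
        have h' : star q * (q * star q * y) = 0 := by rw [h, mul_zero]
        rwa [mul_assoc, ra q1, ← mul_assoc, qs3] at h'
      rw [mul_assoc, this, mul_zero]
    · have : E * (star q * y) = 0 := (hE.2 _).2 fun i => by
        have h' := congrArg (fun t => star q * t) (h i)
        simp only [mul_zero, mul_assoc] at h'
        have Eu : E * star (u i) = star (u i) := by
          have := congrArg star (uE i)
          rwa [star_mul, hE.1.1] at this
        rw [ra q1, mul_assoc, ra Eu, ra (hz.2 _), mul_assoc, ra (hz.2 _), mul_assoc, ra qz] at h'
        rw [mul_assoc]; exact h'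
      rw [ra Eq] at this
      rw [mul_assoc, this, mul_zero]
  have := add_orth hAW hOF (fun i j => by
    simp only [mul_assoc]
    rw [ra (hz.2 (star q)).symm, mul_assoc, ra (qu j)]; simp) hS1 hS2
  exact ProjEquiv.trans pE ⟨q, q1, rfl⟩ this

theorem OF.star {ι : Type*} {u : ι → A} (hu : OF u) : OF (fun i => star (u i)) := by
  refine ⟨fun i => ?_, fun i j hij => ?_⟩
  · have := congrArg Star.star (hu.1 i)
    simpa [mul_assoc] using this
  · simpa using (hu.2 i j hij).symm

theorem ProjEquiv.of_central {e f z : A} (he : IsProjection e) (hf : IsProjection f)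
    (hz : IsCentralProj z) (h1 : ProjEquiv (z * e) (z * f))
    (h2 : ProjEquiv ((1 - z) * e) ((1 - z) * f)) : ProjEquiv e f := by
  have hz' := hz.one_sub
  have o : ∀ e : A, z * e * ((1 - z) * e) = 0 := fun e => by
    rw [mul_assoc, ra (hz'.2 e).symm, mul_assoc, ← mul_assoc z, mul_sub, hz.1.2]; simp
  have := ProjEquiv.add (hz.mul he) (hz'.mul he) (hz.mul hf) (hz'.mul hf) h1 h2 (o e) (o f)
  rw [← add_mul, ← add_mul] at this
  simpa using this

theorem add_half (hAW : IsAWStarRing A) {ι : Type*} {u : ι → A} (hu : OF u) {E F E' F' : A}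
    (hE : Sp (fun i => star (u i) * u i) E) (hF : Sp (fun i => u i * star (u i)) F)
    (hEE : ProjEquiv E E') (h0' : E' * E = 0)
    (hFF : ProjEquiv F F') (h0 : F' * F = 0) : ProjEquiv E F := by
  obtain ⟨z, hz, z1, z2⟩ := gc hAW hE.1 hF.1
  refine ProjEquiv.of_central hE.1 hF.1 hz (add_half_aux hAW hu hE hF hFF h0 hz z1) ?_
  refine (add_half_aux hAW hu.star (E := F) (F := E) ?_ ?_ hEE h0' hz.one_sub z2).symm
  · simpa using hF
  · simpa using hE

theorem split (hAW : IsAWStarRing A) {ι : Type*} {s : ι → A} (hs : OF s)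
    (h0 : ∀ i j, s i * s j = 0) :
    ∃ E F, Sp (fun i => star (s i) * s i) E ∧ ProjEquiv E F ∧ E * F = 0 ∧ IsProjection F ∧
      Sp (fun i => star (s i) * s i + s i * star (s i)) (E + F) := by
  obtain ⟨E, hE⟩ := exists_sp hAW (fun i => star (s i) * s i)
  obtain ⟨F, hF⟩ := exists_sp hAW (fun i => s i * star (s i))
  have ef : E * F = 0 := (hE.2 _).2 fun w => hF.zero_left (fun w => by simp) fun w' => by
    rw [mul_assoc, ra (h0 w w')]; simp
  have fe := hF.1.zero_symm hE.1 ef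
  refine ⟨E, F, hE, add_orth hAW hs h0 hE hF, ef, hF.1, hE.1.add hF.1 fe, fun y => ⟨fun h i => ?_, fun h => ?_⟩⟩
  · have h1 : E * y = 0 := by
      have : E * ((E + F) * y) = 0 := by rw [h, mul_zero]
      rwa [← mul_assoc, mul_add, hE.1.2, ef, add_zero] at this
    have h2 : F * y = 0 := by
      have : F * ((E + F) * y) = 0 := by rw [h, mul_zero]
      rwa [← mul_assoc, mul_add, hF.1.2, fe, zero_add] at this
    rw [add_mul, (hE.2 y).1 h1 i, (hF.2 y).1 h2 i, add_zero]
  · have h1 : E * y = 0 := (hE.2 y).2 fun i => by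
      have := congrArg (fun t => star (s i) * s i * t) (h i)
      simp only [mul_zero] at this
      rw [← mul_assoc, mul_add] at this
      have k1 : star (s i) * s i * (star (s i) * s i) = star (s i) * s i := (proj_of_pi (hs.1 i)).2
      have k2 : star (s i) * s i * (s i * star (s i)) = 0 := by rw [mul_assoc, ra (h0 i i)]; simp
      rwa [k1, k2, add_zero] at this
    have h2 : F * y = 0 := (hF.2 y).2 fun i => by
      have := congrArg (fun t => s i * star (s i) * t) (h i)
      simp only [mul_zero] at this
      rw [← mul_assoc, mul_add] at this
      have k1 : s i * star (s i) * (s i * star (s i)) = s i * star (s i) := (proj_of_pi' (hs.1 i)).2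
      have k3 : star (s i) * star (s i) = 0 := by simpa using congrArg star (h0 i i)
      have k2 : s i * star (s i) * (star (s i) * s i) = 0 := by rw [mul_assoc, ra k3]; simp
      rwa [k1, k2, zero_add] at this
    rw [add_mul, h1, h2, add_zero]

theorem add_gen (hAW : IsAWStarRing A) (hNA : ∀ e : A, IsAbelianProj e → e = 0)
    {ι : Type*} {w : ι → A} (hw : OF w) {e f : A}
    (he : Sp (fun i => star (w i) * w i) e) (hf : Sp (fun i => w i * star (w i)) f) :
    ProjEquiv e f := by
  choose s s1 s2 s3 using fun i => halve hAW hNA (proj_of_pi (hw.1 i))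
  have ws : ∀ i, star (w i) * (w i * s i) = s i := fun i => by
    rw [← mul_assoc, ← s2, add_mul, mul_assoc, s3, mul_zero, zero_add, s1]
  have sw : ∀ i, s i * (star (w i) * w i) = s i := fun i => by
    rw [← s2, mul_add, ra (s3 i), zero_mul, add_zero, ← mul_assoc, s1]
  have ws' : ∀ i, star (w i) * (w i * star (s i)) = star (s i) := fun i => by
    simpa [mul_assoc] using congrArg star (sw i)
  have sw' : ∀ i, star (s i) * (star (w i) * w i) = star (s i) := fun i => by
    simpa [mul_assoc] using congrArg star (ws i)
  have rws : ∀ i x, star (w i) * (w i * (s i * x)) = s i * x := fun i x => by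
    rw [← mul_assoc (w i), ra (ws i)]
  have rws' : ∀ i x, star (w i) * (w i * (star (s i) * x)) = star (s i) * x := fun i x => by
    rw [← mul_assoc (w i), ra (ws' i)]
  have s1' : ∀ i, s i * (star (s i) * s i) = s i := fun i => by rw [← mul_assoc, s1]
  have s1'' : ∀ i, star (s i) * (s i * star (s i)) = star (s i) := fun i => by
    simpa [mul_assoc] using congrArg star (s1 i)
  have rs1 : ∀ i x, s i * (star (s i) * (s i * x)) = s i * x := fun i x => by
    rw [← mul_assoc (star (s i)), ra (s1' i)]
  have oww : ∀ i j, i ≠ j → ∀ x, star (w i) * (w j * x) = 0 := fun i j h x => by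
    rw [ra (hw.2 i j h).1, zero_mul]
  have oww' : ∀ i j, i ≠ j → ∀ x, w i * (star (w j) * x) = 0 := fun i j h x => by
    rw [ra (hw.2 i j h).2, zero_mul]
  have hs : OF s := by
    refine ⟨s1, fun i j hij => ⟨?_, ?_⟩⟩
    · rw [← ws j, ← sw' i]; simp only [mul_assoc]; rw [oww' i j hij]; simp
    · rw [← ws' j, ← sw i]; simp only [mul_assoc]; rw [oww' i j hij]; simp
  have ss : ∀ i j, s i * s j = 0 := fun i j => by
    by_cases hij : i = j
    · subst hij; exact s3 i
    · rw [← ws j, ← sw i]; simp only [mul_assoc]; rw [oww' i j hij]; simp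
  have ht : OF (fun i => w i * s i * star (w i)) := by
    refine ⟨fun i => ?_, fun i j hij => ⟨?_, ?_⟩⟩
    · simp only [star_mul, star_star, mul_assoc, rws, rws', rs1]
    · simp only [star_mul, star_star, mul_assoc, oww i j hij, mul_zero]
    · simp only [star_mul, star_star, mul_assoc, oww i j hij, mul_zero]
  have tt : ∀ i j, (w i * s i * star (w i)) * (w j * s j * star (w j)) = 0 := fun i j => by
    by_cases hij : i = j
    · subst hij
      simp only [mul_assoc, rws]; rw [ra (s3 i)]; simp
    · simp only [mul_assoc, oww i j hij, mul_zero]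
  obtain ⟨E, E', hE, hEE, oE, pE', hE2⟩ := split hAW hs ss
  obtain ⟨F, F', hF, hFF, oF, pF', hF2⟩ := split hAW ht tt
  have e1 : e = E + E' := by
    simp only [s2] at hE2
    exact he.eq hE2
  have f1 : f = F + F' := by
    refine hf.eq ?_
    convert hF2 using 2 with i
    have := congrArg (fun t => w i * t * star (w i)) (s2 i)
    simp only [mul_add, add_mul, mul_assoc] at this
    simp only [star_mul, star_star, mul_assoc, rws, rws', this]
    have h1 := hw.1 i
    rw [mul_assoc] at h1
    rw [← mul_assoc (star (w i)), ra h1]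
  have hu : OF (fun i => w i * (star (s i) * s i)) := by
    refine ⟨fun i => ?_, fun i j hij => ⟨?_, ?_⟩⟩
    · simp only [star_mul, star_star, mul_assoc, rws, rws', rs1, s1']
    · simp only [star_mul, star_star, mul_assoc, oww i j hij, mul_zero]
    · simp only [star_mul, star_star, mul_assoc]
      have : s i * star (s j) = 0 := (hs.2 i j hij).2
      rw [ra this]; simp
  have key : ProjEquiv E F := by
    refine add_half hAW hu ?_ ?_ hEE (pE'.zero_symm hE.1 oE) hFF (pF'.zero_symm hF.1 oF)
    · simpa only [star_mul, star_star, mul_assoc, rws, rws', rs1, s1'] using hE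
    · simpa only [star_mul, star_star, mul_assoc, rws, rws', rs1, s1'] using hF
  rw [e1, f1]
  refine ProjEquiv.add hE.1 pE' hF.1 pF' key ?_ oE oF
  exact (hEE.symm.trans pE' key).trans pE' hFF

end Additivity

section FiniteAlg

set_option linter.unusedSimpArgs false
set_option linter.unusedVariables false

variable {A : Type*} [CStarAlgebra A]

theorem isProj_one : IsProjection (1 : A) := ⟨by simp, by simp⟩

theorem cancel_aux (hfin : ProjFinite (1 : A)) {e f z : A} (he : IsProjection e)
    (h : ProjEquiv e f) (hz : IsCentralProj z)
    (hs : ProjSubEquiv (z * (1 - e)) (z * (1 - f))) :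
    ProjEquiv (z * (1 - e)) (z * (1 - f)) := by
  have hf := h.proj he
  obtain ⟨g, hg, hle, heq⟩ := hs
  have hle : g * (z * (1 - f)) = g := hle
  have c : ∀ e : A, IsProjection e → z * e * (z * (1 - e)) = 0 := fun e he => by
    rw [mul_assoc, ra (hz.2 e).symm, mul_assoc, mul_sub, he.2]; simp
  have gz : g * z = g := by
    rw [← hle, mul_assoc, mul_assoc, ← hz.2, ra hz.1.2]
  have gf : g * (z * f) = 0 := by
    rw [← hle, mul_assoc, mul_assoc, ra (hz.2 (1 - f)).symm, mul_assoc, sub_mul, hf.2]; simp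
  have fg := (hz.mul hf).zero_symm hg gf
  have k1 : ProjEquiv (z * e + z * (1 - e)) (z * f + g) :=
    ProjEquiv.add (hz.mul he) (hz.mul he.one_sub) (hz.mul hf) hg (h.central hz) heq (c e he) fg
  have s1 : ∀ e : A, z * e + z * (1 - e) = z := fun e => by rw [← mul_add]; simp
  rw [s1] at k1
  have hp := k1.proj hz.1
  have zz : z * (1 - z) = 0 := by rw [mul_sub, hz.1.2]; simp
  have gz' : g * (1 - z) = 0 := by rw [mul_sub, gz]; simp
  have o : (z * f + g) * (1 - z) = 0 := by
    rw [add_mul, gz', hz.2 f, mul_assoc, zz]; simp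
  have k2 := ProjEquiv.add hz.1 hz.one_sub.1 hp hz.one_sub.1 k1 (ProjEquiv.refl hz.one_sub.1) zz o
  have e1 : z + (1 - z) = 1 := by abel
  rw [e1] at k2
  have k3 := hfin _ (k2.proj isProj_one) k2 (by simp [ProjLE])
  have : g = z * (1 - f) := by
    have : z * f + g = z := add_right_cancel (k3.trans e1.symm)
    rw [mul_sub, mul_one]; exact eq_sub_of_add_eq' this
  rwa [← this]

theorem cancel (hAW : IsAWStarRing A) (hfin : ProjFinite (1 : A)) {e f : A}
    (he : IsProjection e) (h : ProjEquiv e f) : ProjEquiv (1 - e) (1 - f) := by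
  have hf := h.proj he
  obtain ⟨z, hz, z1, z2⟩ := gc hAW he.one_sub hf.one_sub
  exact ProjEquiv.of_central he.one_sub hf.one_sub hz (cancel_aux hfin he h hz z1)
    (cancel_aux hfin hf h.symm hz.one_sub z2).symm

theorem cancel_rel (hAW : IsAWStarRing A) (hfin : ProjFinite (1 : A)) {f p g : A}
    (hf : IsProjection f) (hp : IsProjection p) (hg : IsProjection g)
    (h : ProjEquiv p g) (hpf : p * f = p) (hgf : g * f = g) : ProjEquiv (f - p) (f - g) := by
  have o1 : p * (1 - f) = 0 := by rw [mul_sub, hpf]; simp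
  have o2 : g * (1 - f) = 0 := by rw [mul_sub, hgf]; simp
  have := cancel hAW hfin (hp.add hf.one_sub (hf.one_sub.zero_symm hp o1))
    (ProjEquiv.add hp hf.one_sub hg hf.one_sub h (ProjEquiv.refl hf.one_sub) o1 o2)
  have e1 : 1 - (p + (1 - f)) = f - p := by abel
  have e2 : 1 - (g + (1 - f)) = f - g := by abel
  rwa [e1, e2] at this

theorem fin_le (hfin : ProjFinite (1 : A)) {e f : A} (he : IsProjection e)
    (h : ProjEquiv e f) (hle : f * e = f) : f = e := by
  have hf := h.proj he
  have o1 : e * (1 - e) = 0 := by rw [mul_sub, he.2]; simp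
  have o2 : f * (1 - e) = 0 := by rw [mul_sub, hle]; simp
  have k2 := ProjEquiv.add he he.one_sub hf he.one_sub h (ProjEquiv.refl he.one_sub) o1 o2
  have e1 : e + (1 - e) = 1 := by abel
  rw [e1] at k2
  have k3 := hfin _ (k2.proj isProj_one) k2 (by simp [ProjLE])
  exact add_right_cancel (k3.trans e1.symm)

theorem no_inf (hAW : IsAWStarRing A) (hNA : ∀ e : A, IsAbelianProj e → e = 0)
    (hfin : ProjFinite (1 : A)) {r : A} (hr : IsProjection r) (v : ℕ → A)
    (hv : ∀ k, star (v k) * v k = r) (ho : ∀ i j, i ≠ j → star (v i) * v j = 0) : r = 0 := by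
  have vr : ∀ k, v k * r = v k := fun k => pi_right hr (hv k)
  have rv : ∀ k, r * star (v k) = star (v k) := fun k => by
    have := congrArg star (vr k)
    rwa [star_mul, hr.1] at this
  have hw : OF (fun k => v (k + 1) * star (v k)) := by
    refine ⟨fun k => ?_, fun i j hij => ⟨?_, ?_⟩⟩
    · simp only [star_mul, star_star, mul_assoc]
      rw [ra (hv k), ra (hv (k + 1)), rv, rv]
    · simp only [star_mul, star_star, mul_assoc]
      rw [ra (ho (i + 1) (j + 1) (by omega))]; simp
    · simp only [star_mul, star_star, mul_assoc]
      rw [ra (ho i j hij)]; simp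
  obtain ⟨E, hE⟩ := exists_sp hAW (fun k => v k * star (v k))
  obtain ⟨F, hF⟩ := exists_sp hAW (fun k => v (k + 1) * star (v (k + 1)))
  have heq : ProjEquiv E F := by
    refine add_gen hAW hNA hw ?_ ?_
    · convert hE using 2 with k
      simp only [star_mul, star_star, mul_assoc]
      rw [ra (hv (k + 1)), rv]
    · convert hF using 2 with k
      simp only [star_mul, star_star, mul_assoc]
      rw [ra (hv k), rv]
  have hle : F * E = F := by
    have : F * (1 - E) = 0 := (hF.2 _).2 fun k => by
      have := hE.mul_right (k + 1)
      rw [mul_sub, this]; simp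
    rw [mul_sub, mul_one, sub_eq_zero] at this; exact this.symm
  have hFE := fin_le hfin hE.1 heq hle
  have h1 : F * (v 0 * star (v 0)) = 0 := (hF.2 _).2 fun k => by
    rw [mul_assoc, ra (ho (k + 1) 0 (by omega))]; simp
  have h2 := hE.mul_left (i := 0) (by simp)
  rw [← hFE, h1] at h2
  have h3 := (CStarRing.mul_star_self_eq_zero_iff (v 0)).1 h2.symm
  rw [← hv 0, h3, mul_zero]

theorem proj_sum {e : ℕ → A} (k : ℕ) (h : ∀ i < k, IsProjection (e i))
    (o : ∀ i < k, ∀ j < k, i ≠ j → e i * e j = 0) : IsProjection (∑ i ∈ Finset.range k, e i) := by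
  induction k with
  | zero => simp [IsProjection]
  | succ k ih =>
    rw [Finset.sum_range_succ]
    refine (ih (fun i hi => h i (by omega)) (fun i hi j hj => o i (by omega) j (by omega))).add
      (h k (by omega)) ?_
    rw [Finset.mul_sum]
    refine Finset.sum_eq_zero fun i hi => ?_
    have := Finset.mem_range.1 hi
    exact o k (by omega) i (by omega) (by omega)

theorem equiv_sum {e e' : ℕ → A} (k : ℕ) (h : ∀ i < k, IsProjection (e i))
    (o : ∀ i < k, ∀ j < k, i ≠ j → e i * e j = 0) (h' : ∀ i < k, IsProjection (e' i))
    (o' : ∀ i < k, ∀ j < k, i ≠ j → e' i * e' j = 0) (heq : ∀ i < k, ProjEquiv (e i) (e' i)) :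
    ProjEquiv (∑ i ∈ Finset.range k, e i) (∑ i ∈ Finset.range k, e' i) := by
  induction k with
  | zero => exact ⟨0, by simp, by simp⟩
  | succ k ih =>
    rw [Finset.sum_range_succ, Finset.sum_range_succ]
    refine ProjEquiv.add (proj_sum k (fun i hi => h i (by omega)) (fun i hi j hj => o i (by omega) j (by omega)))
      (h k (by omega)) (proj_sum k (fun i hi => h' i (by omega)) (fun i hi j hj => o' i (by omega) j (by omega)))
      (h' k (by omega)) (ih (fun i hi => h i (by omega)) (fun i hi j hj => o i (by omega) j (by omega))
        (fun i hi => h' i (by omega)) (fun i hi j hj => o' i (by omega) j (by omega))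
        (fun i hi => heq i (by omega))) (heq k (by omega)) ?_ ?_
    · rw [Finset.sum_mul]
      refine Finset.sum_eq_zero fun i hi => ?_
      have := Finset.mem_range.1 hi
      exact o i (by omega) k (by omega) (by omega)
    · rw [Finset.sum_mul]
      refine Finset.sum_eq_zero fun i hi => ?_
      have := Finset.mem_range.1 hi
      exact o' i (by omega) k (by omega) (by omega)

theorem tuple (hAW : IsAWStarRing A) (hNA : ∀ e : A, IsAbelianProj e → e = 0) (n : ℕ) :
    ∀ r : A, IsProjection r → r ≠ 0 → ∃ (p : A) (w : ℕ → A), p ≠ 0 ∧ IsProjection p ∧ p * r = p ∧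
      (∀ i < n, star (w i) * w i = p) ∧ (∀ i < n, r * w i = w i) ∧
      ∀ i < n, ∀ j < n, i ≠ j → star (w i) * w j = 0 := by
  induction n with
  | zero =>
    intro r hr h0
    exact ⟨r, fun _ => 0, h0, hr, hr.2, by simp, by simp, by simp⟩
  | succ n ih =>
    intro r hr h0
    obtain ⟨s, s1, s2, s3⟩ := halve hAW hNA hr
    have px := proj_of_pi s1
    have x0 : star s * s ≠ 0 := by
      intro h
      have := (CStarRing.star_mul_self_eq_zero_iff s).1 h
      apply h0; rw [← s2, this]; simp
    obtain ⟨p, w, p0, hp, hpx, w1, w2, w3⟩ := ih _ px x0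
    have xr : (star s * s) * r = star s * s := by
      rw [← s2, mul_add, px.2]
      have : star s * s * (s * star s) = 0 := by rw [mul_assoc, ra s3]; simp
      rw [this, add_zero]
    have rx := hr.le_symm px xr
    have rs : r * s = s := by rw [← s2, add_mul, mul_assoc, s3, s1]; simp
    have xs : (star s * s) * s = 0 := by rw [mul_assoc, s3, mul_zero]
    refine ⟨p, fun i => if i < n then w i else s * p, p0, hp, ?_, ?_, ?_, ?_⟩
    · rw [← hpx, mul_assoc, xr]
    · intro i hi
      by_cases h : i < n
      · simp only [h, if_true]; exact w1 i h
      · simp only [h, if_false]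
        rw [star_mul, hp.1, mul_assoc, ← mul_assoc (star s), ← mul_assoc, hpx, hp.2]
    · intro i hi
      by_cases h : i < n
      · simp only [h, if_true]; rw [← w2 i h, ra rx]
      · simp only [h, if_false]; rw [ra rs]
    · have o : ∀ i < n, star (w i) * (s * p) = 0 := fun i hi => by
        rw [← w2 i hi, star_mul, px.1, mul_assoc, ra xs]; simp
      intro i hi j hj hij
      by_cases h : i < n
      · by_cases h' : j < n
        · simp only [h, h', if_true]; exact w3 i h j h' hij
        · simp only [h, h', if_true, if_false]; exact o i h
      · have h' : j < n := by omega
        simp only [h, h', if_true, if_false]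
        simpa using congrArg star (o j h')

theorem n_split (hAW : IsAWStarRing A) (hNA : ∀ e : A, IsAbelianProj e → e = 0) (n : ℕ)
    (hn : 0 < n) :
    ∃ e : ℕ → A, (∀ i, IsProjection (e i)) ∧ (∀ i < n, ∀ j < n, i ≠ j → e i * e j = 0) ∧
      (∀ i < n, ∀ j < n, ProjEquiv (e i) (e j)) ∧ ∑ i ∈ Finset.range n, e i = 1 := by
  obtain ⟨W, hP, hQ, hmax⟩ := zorn_pw
    (fun w : ℕ → A => (∃ p, IsProjection p ∧ ∀ i < n, star (w i) * w i = p) ∧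
      ∀ i < n, ∀ j < n, i ≠ j → star (w i) * w j = 0)
    (fun w w' => ∀ i < n, ∀ j < n, star (w i) * w' j = 0)
  choose e he using fun i => exists_sp hAW (fun w : W => (w : ℕ → A) i * star ((w : ℕ → A) i))
  have o : ∀ i < n, ∀ j < n, i ≠ j → ∀ w w' : W, star ((w : ℕ → A) i) * (w' : ℕ → A) j = 0 := by
    intro i hi j hj hij w w'
    by_cases h : w = w'
    · subst h; exact (hP w w.2).2 i hi j hj hij
    · exact hQ w w.2 w' w'.2 (fun hh => h (Subtype.ext hh)) i hi j hj
  have eo : ∀ i < n, ∀ j < n, i ≠ j → e i * e j = 0 := fun i hi j hj hij =>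
    ((he i).2 _).2 fun w => (he j).zero_left (fun w => by simp) fun w' => by
      rw [mul_assoc, ra (o i hi j hj hij w w')]; simp
  have ee : ∀ i < n, ∀ j < n, ProjEquiv (e i) (e j) := by
    intro i hi j hj
    have hs : ∀ w : W, ∀ i < n, ∀ j < n, (w : ℕ → A) i * (star ((w : ℕ → A) j) * (w : ℕ → A) j) = (w : ℕ → A) i := by
      intro w i hi j hj
      obtain ⟨p, hp, h⟩ := (hP w w.2).1
      rw [h j hj]; exact pi_right hp (h i hi)
    have hs' : ∀ w : W, ∀ i < n, ∀ j < n, star ((w : ℕ → A) j) * ((w : ℕ → A) j * star ((w : ℕ → A) i)) = star ((w : ℕ → A) i) := by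
      intro w i hi j hj
      simpa [mul_assoc] using congrArg star (hs w i hi j hj)
    refine add_gen hAW hNA (w := fun w : W => (w : ℕ → A) j * star ((w : ℕ → A) i)) ?_ ?_ ?_
    · refine ⟨fun w => ?_, fun w w' hne => ⟨?_, ?_⟩⟩
      · simp only [star_mul, star_star, mul_assoc]
        rw [hs' w i hi j hj, hs' w i hi i hi]
      · simp only [star_mul, star_star, mul_assoc]
        rw [ra (hQ w w.2 w' w'.2 (fun hh => hne (Subtype.ext hh)) j hj j hj)]; simp
      · simp only [star_mul, star_star, mul_assoc]
        rw [ra (hQ w w.2 w' w'.2 (fun hh => hne (Subtype.ext hh)) i hi i hi)]; simp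
    · convert he i using 2 with w
      simp only [star_mul, star_star, mul_assoc]
      rw [hs' w i hi j hj]
    · convert he j using 2 with w
      simp only [star_mul, star_star, mul_assoc]
      rw [hs' w j hj i hi]
  refine ⟨e, fun i => (he i).1, eo, ee, ?_⟩
  have hsum := proj_sum n (fun i _ => (he i).1) eo
  by_contra hne
  obtain ⟨p, w', p0, hp, -, w1, w2, w3⟩ := tuple hAW hNA n _ hsum.one_sub
    (fun h => hne (sub_eq_zero.1 h).symm)
  have we : ∀ w : W, ∀ i < n, star ((w : ℕ → A) i) * e i = star ((w : ℕ → A) i) := fun w i hi => by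
    have h1 := (he i).mul_right w
    obtain ⟨p, hp, h⟩ := (hP w w.2).1
    have h2 := pi_self hp (h i hi)
    have h3 : star ((w : ℕ → A) i) * ((w : ℕ → A) i * star ((w : ℕ → A) i)) = star ((w : ℕ → A) i) := by
      simpa [mul_assoc] using congrArg star h2
    rw [← h3, mul_assoc, h1]
  have wr : ∀ w : W, ∀ i < n, star ((w : ℕ → A) i) * (1 - ∑ i ∈ Finset.range n, e i) = 0 := by
    intro w i hi
    rw [mul_sub, mul_one, Finset.mul_sum, Finset.sum_eq_single i, we w i hi, sub_self]
    · intro j hj hji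
      rw [← we w i hi, mul_assoc, eo i hi j (Finset.mem_range.1 hj) hji.symm, mul_zero]
    · intro h; exact absurd (Finset.mem_range.2 hi) h
  have q : ∀ w : W, ∀ i < n, ∀ j < n, star ((w : ℕ → A) i) * w' j = 0 := fun w i hi j hj => by
    rw [← w2 j hj, ra (wr w i hi), zero_mul]
  have hmem : w' ∈ W := hmax w' ⟨⟨p, hp, w1⟩, w3⟩ fun w hw =>
    ⟨q ⟨w, hw⟩, fun i hi j hj => by simpa using congrArg star (q ⟨w, hw⟩ j hj i hi)⟩
  apply p0
  rw [← w1 0 hn]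
  exact q ⟨w', hmem⟩ 0 hn 0 hn

end FiniteAlg

section Masa

set_option linter.unusedSimpArgs false
set_option linter.unusedVariables false

variable {A : Type*} [CStarAlgebra A]

theorem masa_mem_sa {M : StarSubalgebra ℂ A} (hM : IsMaximalAbelian M) {x : A}
    (hx : IsSelfAdjoint x) (h : ∀ m ∈ M, x * m = m * x) : x ∈ M := by
  have hcomm : ∀ a ∈ (M : Set A) ∪ {x}, ∀ b ∈ (M : Set A) ∪ {x}, a * b = b * a := by
    rintro a (ha | rfl) b (hb | rfl)
    · exact hM.1 a ha b hb
    · exact (h a ha).symm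
    · exact h b hb
    · rfl
  have hstar : ∀ a ∈ (M : Set A) ∪ {x}, star a ∈ (M : Set A) ∪ {x} := by
    rintro a (ha | rfl)
    · exact Or.inl (star_mem (S := StarSubalgebra ℂ A) ha)
    · right; rw [hx.star_eq]; rfl
  have hc := StarAlgebra.isMulCommutative_adjoin (R := ℂ) (s := (M : Set A) ∪ {x})
    hcomm (fun a ha b hb => hcomm a ha _ (hstar b hb))
  have := hM.2 (StarAlgebra.adjoin ℂ ((M : Set A) ∪ {x})) (fun a ha b hb => by
      have := hc.is_comm.comm ⟨a, ha⟩ ⟨b, hb⟩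
      exact congrArg Subtype.val this)
    (fun a ha => StarAlgebra.subset_adjoin ℂ _ (Or.inl ha))
  rw [this]
  exact StarAlgebra.subset_adjoin ℂ _ (Or.inr rfl)

theorem masa_mem {M : StarSubalgebra ℂ A} (hM : IsMaximalAbelian M) {x : A}
    (h : ∀ m ∈ M, x * m = m * x) : x ∈ M := by
  have h' : ∀ m ∈ M, star x * m = m * star x := fun m hm => by
    have := congrArg star (h (star m) (star_mem hm))
    simpa using this.symm
  have h1 : (realPart x : A) ∈ M := masa_mem_sa hM (realPart x).2 fun m hm => by
    rw [realPart_apply_coe, smul_mul_assoc, mul_smul_comm, add_mul, mul_add, h m hm, h' m hm]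
  have h2 : (imaginaryPart x : A) ∈ M := masa_mem_sa hM (imaginaryPart x).2 fun m hm => by
    rw [imaginaryPart_apply_coe]
    simp only [smul_mul_assoc, mul_smul_comm, sub_mul, mul_sub, h m hm, h' m hm]
  rw [← realPart_add_I_smul_imaginaryPart x]
  exact add_mem h1 (SMulMemClass.smul_mem _ h2)

theorem sp_mem {M : StarSubalgebra ℂ A} (hM : IsMaximalAbelian M) {ι : Type*} {w : ι → A} {g : A}
    (hg : Sp w g) (hw : ∀ i, w i ∈ M) : g ∈ M :=
  masa_mem hM fun m hm => hg.comm (fun i => hM.1 _ (hw i) _ hm)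
    (fun i => hM.1 _ (hw i) _ (star_mem hm))

theorem central_mem {M : StarSubalgebra ℂ A} (hM : IsMaximalAbelian M) {z : A}
    (hz : IsCentralProj z) : z ∈ M := masa_mem hM fun m _ => hz.2 m

theorem S1 (hAW : IsAWStarRing A) (hNA : ∀ e : A, IsAbelianProj e → e = 0)
    {M : StarSubalgebra ℂ A} (hM : IsMaximalAbelian M) {f : A} (hf : IsProjection f)
    (hfM : f ∈ M) (h0 : f ≠ 0) :
    ∃ q ∈ M, IsProjection q ∧ q * f = q ∧ ∃ c, q * c * (f - q) ≠ 0 := by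
  obtain ⟨m, hmM, hm, b, hne⟩ : ∃ m ∈ M, IsSelfAdjoint m ∧ ∃ b, m * (f * b * f) ≠ (f * b * f) * m := by
    by_contra! H
    have key : ∀ b, f * b * f ∈ M := fun b => masa_mem hM fun m hm => by
      have h1 : (realPart m : A) ∈ M := masa_mem_sa hM (realPart m).2 fun x hx => by
        rw [realPart_apply_coe, smul_mul_assoc, mul_smul_comm, add_mul, mul_add, hM.1 m hm x hx,
          hM.1 _ (star_mem hm) x hx]
      have h2 : (imaginaryPart m : A) ∈ M := masa_mem_sa hM (imaginaryPart m).2 fun x hx => by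
        rw [imaginaryPart_apply_coe]
        simp only [smul_mul_assoc, mul_smul_comm, sub_mul, mul_sub, hM.1 m hm x hx,
          hM.1 _ (star_mem hm) x hx]
      rw [← realPart_add_I_smul_imaginaryPart m, mul_add, add_mul, mul_smul_comm, smul_mul_assoc,
        H _ h1 (realPart m).2, H _ h2 (imaginaryPart m).2]
    exact h0 (hNA f ⟨hf, fun a b => hM.1 _ (key a) _ (key b)⟩)
  obtain ⟨q, hq, hqc, c, hc⟩ := nc hAW hf hm (hM.1 _ hmM _ hfM) (b := f * b * f)
    (by simp only [mul_assoc, hf.2, ra hf.2]) (by simp only [mul_assoc, hf.2, ra hf.2]) hne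
  have hqM : q ∈ M := masa_mem hM fun x hx => hqc x (hM.1 _ hmM _ hx)
  refine ⟨q * f, mul_mem hqM hfM, hq.mul hf (hM.1 _ hfM _ hqM), by rw [mul_assoc, hf.2], c, hc⟩

theorem lemC (hAW : IsAWStarRing A) (hNA : ∀ e : A, IsAbelianProj e → e = 0)
    {M : StarSubalgebra ℂ A} (hM : IsMaximalAbelian M) {p : A} (hp : IsProjection p)
    (hpM : p ∈ M) :
    ∃ q ∈ M, IsProjection q ∧ q * p = q ∧ ∀ y, IsCentralProj y →
      (y * q = 0 → y * p = 0) ∧ (y * (p - q) = 0 → y * p = 0) := by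
  obtain ⟨W, hP, hQ, hmax⟩ := zorn_pw
    (fun q : A => q ∈ M ∧ IsProjection q ∧ q * p = q ∧
      ∀ y, IsCentralProj y → y * (p - q) = 0 → y * q = 0)
    (fun q q' => ∀ a, q * a * q' = 0)
  obtain ⟨q, hq⟩ := exists_sp hAW (fun w : W => (w : A))
  have hqM := sp_mem hM hq (fun w => (hP w w.2).1)
  have hqp : q * p = q := by
    have : q * (1 - p) = 0 := (hq.2 _).2 fun w => by
      rw [mul_sub, (hP w w.2).2.2.1]; simp
    rw [mul_sub, mul_one, sub_eq_zero] at this; exact this.symm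
  refine ⟨q, hqM, hq.1, hqp, fun y hy => ⟨fun h => ?_, fun h => ?_⟩⟩
  · by_contra hne
    obtain ⟨q0, hq0M, hq0, hq0f, c, hc⟩ := S1 hAW hNA hM (hy.mul hp)
      (mul_mem (central_mem hM hy) hpM) hne
    obtain ⟨z, hz, z1, z2⟩ := central_cover hAW (fun _ : Unit => y * p - q0)
    have z1 := z1 ()
    have yq0 : y * q0 = q0 := by
      have : q0 * y = q0 := by rw [← hq0f, mul_assoc, mul_assoc, ← hy.2, ra hy.1.2]
      rw [hy.2, this]
    have q0p : q0 * p = q0 := by rw [← hq0f, mul_assoc, mul_assoc, hp.2]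
    have yq1 : y * (z * q0) = z * q0 := by rw [ra (hy.2 z), mul_assoc, yq0]
    have hq1 : z * q0 ≠ 0 := by
      intro h1
      apply hc
      rw [← z1, ← hz.2, mul_assoc q0, ra (hz.2 c).symm, mul_assoc, ra (hz.2 q0).symm, h1, zero_mul]
    have mem : z * q0 ∈ W := by
      refine hmax _ ⟨mul_mem (central_mem hM hz) hq0M, hz.mul hq0, by rw [mul_assoc, q0p], ?_⟩ ?_
      · intro y' hy' h1
        have h2 : y' * (y * p - q0) = 0 := by
          have e1 : z * (y * p - q0) = y * p - q0 := by rw [hz.2, z1]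
          rw [← e1]
          have e2 : z * (y * p - q0) = (p - z * q0) * (z * y) := by
            have : z * q0 * (z * y) = z * q0 := by
              rw [mul_assoc, ra (hz.2 q0).symm, mul_assoc, ra hz.1.2, ← hy.2, yq0]
            rw [sub_mul, this, mul_sub, ra (hz.2 y), mul_assoc, hz.2 p, ra (hy.2 p), mul_assoc, ← hy.2 z]
          rw [e2, ra h1, zero_mul]
        have h3 := z2 y' fun _ a => by rw [mul_assoc, ← hy'.2 a, ra (hy'.2 _).symm, h2, zero_mul]
        rw [ra (hy'.2 z), h3, zero_mul]
      · have k : ∀ w ∈ W, w * y = 0 := fun w hw => by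
          have := hq.mul_right ⟨w, hw⟩
          have this : w * q = w := this
          rw [← this, mul_assoc, ← hy.2, h, mul_zero]
        have k1 : ∀ w ∈ W, ∀ a, w * a * (z * q0) = 0 := fun w hw a => by
          rw [← yq1, mul_assoc, ra (hy.2 a).symm, mul_assoc, ra (k w hw), zero_mul]
        intro w hw
        refine ⟨k1 w hw, fun a => ?_⟩
        simpa [(hP w hw).2.1.1, (hz.mul hq0).1, mul_assoc, hz.1.1, hq0.1, hz.2] using congrArg star (k1 w hw (star a))
    have this : z * q0 * q = z * q0 := hq.mul_right ⟨_, mem⟩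
    apply hq1
    rw [← yq1, ← this, ra (hy.2 _), mul_assoc, h, mul_zero]
  · have hyq : q * y = 0 := (hq.2 y).2 fun w => by
      obtain ⟨z, hz, z1, z2⟩ := central_cover hAW (fun _ : Unit => (w : A))
      have z1 : (w : A) * z = w := z1 ()
      have zq : q * z = w := by
        have h1 : q * (z - w) = 0 := (hq.2 _).2 fun w' => by
          by_cases hw : w' = w
          · subst hw; rw [mul_sub, z1, (hP w' w'.2).2.1.2, sub_self]
          · have h2 : z * (w' : A) = 0 := z2 w' fun _ a =>
              hQ w w.2 w' w'.2 (fun hh => hw (Subtype.ext hh.symm)) a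
            have h3 := hQ w' w'.2 w w.2 (fun hh => hw (Subtype.ext hh)) 1
            rw [mul_one] at h3
            rw [mul_sub, h3, ← hz.2, h2, sub_self]
        have h4 : q * w = w := hq.mul_left (i := w) (hP w w.2).2.1.1
        rw [mul_sub, h4, sub_eq_zero] at h1
        exact h1
      have h1 := (hP w w.2).2.2.2 (y * z) ⟨hy.1.mul hz.1 (hz.2 y), fun a => by
        rw [mul_assoc, hz.2 a, ra (hy.2 a), mul_assoc]⟩ (by
          have : z * (p - w) = z * (p - q) := by
            rw [mul_sub, mul_sub, hz.2 (w : A), z1, hz.2 q, zq]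
          rw [mul_assoc, this, ra (hy.2 z), mul_assoc, h, mul_zero])
      rw [mul_assoc, hz.2, z1, hy.2] at h1
      exact h1
    rwa [mul_sub, hy.2 q, hyq, sub_zero] at h

theorem small (hAW : IsAWStarRing A) (hNA : ∀ e : A, IsAbelianProj e → e = 0)
    (hfin : ProjFinite (1 : A)) {M : StarSubalgebra ℂ A} (hM : IsMaximalAbelian M) {f r : A}
    (hf : IsProjection f) (hfM : f ∈ M) (hr : IsProjection r) (h0 : r ≠ 0)
    (hrf : ProjSubEquiv r f) :
    ∃ p ∈ M, IsProjection p ∧ p ≠ 0 ∧ p * f = p ∧ ProjSubEquiv p r := by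
  by_contra! H
  obtain ⟨v, v1, v2, v3⟩ := hrf.elim hf
  have mulle : ∀ {z q : A}, IsCentralProj z → IsProjection q → ProjSubEquiv (z * q) q :=
    fun {z q} hz hq => ProjSubEquiv.of_le (hz.mul hq) (by rw [mul_assoc, hq.2])
  have big : ∀ q ∈ M, IsProjection q → q * f = q →
      (∀ y, IsCentralProj y → y * q = 0 → y * f = 0) → ProjSubEquiv r q := by
    intro q hqM hq hqf hy
    obtain ⟨z, hz, z1, z2⟩ := gc hAW hq hr
    have k1 : z * q = 0 := by
      by_contra hne
      exact H (z * q) (mul_mem (central_mem hM hz) hqM) (hz.mul hq) hne (by rw [mul_assoc, hqf])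
        (z1.trans (hz.mul hq) (hz.mul hr) hr (mulle hz hr))
    have k2 := hy z hz k1
    have k3 : z * r = 0 := by
      rw [← v1, ← v2, ra (hz.2 _), mul_assoc, ra k2]; simp
    have k4 : (1 - z) * r = r := by rw [sub_mul, k3]; simp
    rw [k4] at z2
    exact z2.trans hr (hz.one_sub.mul hq) hq (mulle hz.one_sub hq)
  choose g gM gp gle gy using fun p : {p : A // IsProjection p ∧ p ∈ M} =>
    lemC hAW hNA hM p.2.1 p.2.2
  let P : ℕ → {p : A // IsProjection p ∧ p ∈ M} := fun k =>
    Nat.rec ⟨f, hf, hfM⟩ (fun _ p => ⟨g p, gp p, gM p⟩) k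
  have Ps : ∀ k, (P (k + 1) : A) = g (P k) := fun k => rfl
  have mono : ∀ i k, (P (i + k)).1 * (P i).1 = (P (i + k)).1 := by
    intro i k
    induction k with
    | zero => exact (P i).2.1.2
    | succ k ih =>
      rw [← add_assoc, Ps]
      rw [← gle (P (i + k)), mul_assoc, ih]
  have Pf : ∀ k, (P k).1 * f = (P k).1 := fun k => by
    have := mono 0 k
    rwa [zero_add] at this
  have Py : ∀ (k : ℕ) (y : A), IsCentralProj y → y * (P k).1 = 0 → y * f = 0 := by
    intro k
    induction k with
    | zero => exact fun y _ h => h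
    | succ k ih => exact fun y hy h => ih y hy ((gy (P k) y hy).1 h)
  have hd : ∀ k, ProjSubEquiv r ((P k).1 - (P (k + 1)).1) := fun k => by
    refine big _ (sub_mem (P k).2.2 (P (k + 1)).2.2) ((P k).2.1.sub (P (k + 1)).2.1 (gle (P k))) ?_ ?_
    · rw [sub_mul]; exact congrArg₂ _ (Pf k) (Pf (k + 1))
    · intro y hy h
      exact Py k y hy ((gy (P k) y hy).2 h)
  have pd : ∀ k, IsProjection ((P k).1 - (P (k + 1)).1) := fun k =>
    (P k).2.1.sub (P (k + 1)).2.1 (gle (P k))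
  choose w w1 w2 w3 using fun k => (hd k).elim (pd k)
  apply h0
  have od : ∀ i k, ((P (i + 1 + k)).1 - (P (i + 1 + k + 1)).1) * ((P i).1 - (P (i + 1)).1) = 0 := by
    intro i k
    have a1 := mono (i + 1) k
    have a2 := mono (i + 1) (k + 1)
    have a3 := mono i (1 + k)
    have a4 := mono i (1 + (k + 1))
    simp only [← add_assoc] at a1 a2 a3 a4
    rw [mul_sub, sub_mul, sub_mul, a1, a2, a3, a4, sub_self]
  have oo : ∀ i k, star (w (i + 1 + k)) * w i = 0 := fun i k => by
    have : star (w (i + 1 + k)) * ((P (i + 1 + k)).1 - (P (i + 1 + k + 1)).1) = star (w (i + 1 + k)) := by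
      have := congrArg star (w2 (i + 1 + k))
      rwa [star_mul, (pd _).1] at this
    rw [← this, ← w2 i, mul_assoc, ra (od i k)]; simp
  refine no_inf hAW hNA hfin hr w w1 fun i j hij => ?_
  rcases lt_or_gt_of_ne hij with h | h
  · obtain ⟨k, rfl⟩ := Nat.exists_eq_add_of_lt h
    have := oo i k
    rw [show i + 1 + k = i + k + 1 by omega] at this
    simpa using congrArg star this
  · obtain ⟨k, rfl⟩ := Nat.exists_eq_add_of_lt h
    have := oo j k
    rwa [show j + 1 + k = j + k + 1 by omega] at this

theorem lemT (hAW : IsAWStarRing A) (hNA : ∀ e : A, IsAbelianProj e → e = 0)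
    (hfin : ProjFinite (1 : A)) {M : StarSubalgebra ℂ A} (hM : IsMaximalAbelian M) {e f : A}
    (he : IsProjection e) (hf : IsProjection f) (hfM : f ∈ M) (hef : ProjSubEquiv e f) :
    ∃ p ∈ M, IsProjection p ∧ p * f = p ∧ ProjEquiv p e := by
  obtain ⟨W, p, g, hW, hOF, hp, hg, l1, l2, hmax⟩ := zorn_pi hAW hf he (fun w => star w * w ∈ M)
  have hpM := sp_mem hM hp (fun w => (hW w w.2).1)
  have hpg := add_gen hAW hNA hOF hp hg
  refine ⟨p, hpM, hp.1, l1, ?_⟩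
  by_cases hge : g = e
  · rwa [← hge]
  exfalso
  obtain ⟨v, v1, v2, v3⟩ := hef.elim hf
  have eg := he.le_symm hg.1 l2
  obtain ⟨r1, r2, r3, r4⟩ := equiv_restrict he v1 rfl hg.1 l2
  have hr := he.sub hg.1 l2
  have gr : g * (e - g) = 0 := by rw [mul_sub, l2, hg.1.2, sub_self]
  have vf : star v * f = star v := by
    have := congrArg star v2
    rwa [star_mul, hf.1] at this
  have g1f : v * g * star v * f = v * g * star v := by rw [mul_assoc, vf]
  have k1 : ProjEquiv (v * g * star v) p := (ProjEquiv.symm ⟨v * g, r1, r2⟩).trans r3 hpg.symm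
  have k2 := cancel_rel hAW hfin hf r3 hp.1 k1 g1f l1
  have k3 : ProjSubEquiv (e - g) (f - v * g * star v) := by
    refine ProjSubEquiv.intro (v := v * (e - g)) hr (hf.sub r3 g1f) ?_ ?_
    · rw [star_mul, hr.1, mul_assoc, ra v1, ← mul_assoc]
      rw [sub_mul, he.2, l2, hr.2]
    · rw [sub_mul, ra v2, mul_assoc, mul_assoc, ra v1, mul_sub e, he.2, eg, gr, mul_zero, sub_zero]
  have hfp := hf.sub hp.1 l1
  have k4 := k3.trans hr (hf.sub r3 g1f) hfp (k2.sub (hf.sub r3 g1f))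
  obtain ⟨p', p'M, hp', p'0, p'f, hs⟩ := small hAW hNA hfin hM hfp (sub_mem hfM hpM) hr
    (fun h => hge (sub_eq_zero.1 h).symm) k4
  obtain ⟨u, u1, u2, u3⟩ := hs.elim hr
  have := hmax u (pi_self hp' u1) (by rw [u1]; exact p'M) u2 (by rw [← u3, mul_assoc, p'f])
  apply p'0
  rw [← u1, this, mul_zero]

theorem final (hAW : IsAWStarRing A) (hNA : ∀ e : A, IsAbelianProj e → e = 0)
    (hfin : ProjFinite (1 : A)) {M : StarSubalgebra ℂ A} (hM : IsMaximalAbelian M)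
    (n : ℕ) (hn : 0 < n) :
    ∃ p : Fin n → A, (∀ i, p i ∈ M) ∧ (∀ i, IsProjection (p i)) ∧
      PairwiseOrthogonal p ∧ (∀ i j, ProjEquiv (p i) (p j)) ∧ ∑ i, p i = 1 := by
  obtain ⟨e, he, eo, ee, es⟩ := n_split hAW hNA n hn
  have key : ∀ k ≤ n, ∃ p : ℕ → A, (∀ i < k, p i ∈ M) ∧ (∀ i < k, IsProjection (p i)) ∧
      (∀ i < k, ∀ j < k, i ≠ j → p i * p j = 0) ∧ (∀ i < k, ProjEquiv (p i) (e i)) := by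
    intro k
    induction k with
    | zero => exact fun _ => ⟨fun _ => 0, by simp, by simp, by simp, by simp⟩
    | succ k ih =>
      intro hk
      obtain ⟨p, pM, hp, po, pe⟩ := ih (by omega)
      have eo' : ∀ i < k, ∀ j < k, i ≠ j → e i * e j = 0 :=
        fun i hi j hj => eo i (by omega) j (by omega)
      have hP := proj_sum k hp po
      have hE := proj_sum k (fun i _ => he i) eo'
      have h1 := cancel hAW hfin hP (equiv_sum k hp po (fun i _ => he i) eo' pe)
      have h2 : e k * (1 - ∑ i ∈ Finset.range k, e i) = e k := by
        rw [mul_sub, mul_one, Finset.mul_sum, Finset.sum_eq_zero, sub_zero]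
        intro i hi
        have := Finset.mem_range.1 hi
        exact eo k (by omega) i (by omega) (by omega)
      obtain ⟨q, qM, hq, qP, hqe⟩ := lemT hAW hNA hfin hM (he k) hP.one_sub
        (sub_mem (one_mem M) (sum_mem fun i hi => pM i (Finset.mem_range.1 hi)))
        ((ProjSubEquiv.of_le (he k) h2).trans (he k) hE.one_sub hP.one_sub (h1.symm.sub hE.one_sub))
      have qp : ∀ i < k, q * p i = 0 := fun i hi => by
        have : (1 - ∑ i ∈ Finset.range k, p i) * p i = 0 := by
          rw [sub_mul, one_mul, Finset.sum_mul, Finset.sum_eq_single i, (hp i hi).2, sub_self]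
          · intro j hj hji
            exact po j (Finset.mem_range.1 hj) i hi hji
          · intro h; exact absurd (Finset.mem_range.2 hi) h
        rw [← qP, mul_assoc, this, mul_zero]
      refine ⟨fun i => if i < k then p i else q, ?_, ?_, ?_, ?_⟩
      · intro i hi
        by_cases h : i < k
        · simpa only [h, if_true] using pM i h
        · simpa only [h, if_false] using qM
      · intro i hi
        by_cases h : i < k
        · simpa only [h, if_true] using hp i h
        · simpa only [h, if_false] using hq
      · intro i hi j hj hij
        by_cases h : i < k
        · by_cases h' : j < k
          · simpa only [h, h', if_true] using po i h j h' hij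
          · simpa only [h, h', if_true, if_false] using (hp i h).zero_symm hq (qp i h)
        · have h' : j < k := by omega
          simpa only [h, h', if_true, if_false] using qp j h'
      · intro i hi
        by_cases h : i < k
        · simpa only [h, if_true] using pe i h
        · have : i = k := by omega
          subst this
          simpa only [h, if_false] using hqe
  obtain ⟨p, pM, hp, po, pe⟩ := key n le_rfl
  refine ⟨fun i => p i, fun i => pM i i.2, fun i => hp i i.2,
    fun i j hij => po i i.2 j j.2 (fun h => hij (Fin.ext h)), fun i j => ?_, ?_⟩
  · exact ((pe i i.2).trans (hp i i.2) (ee i i.2 j j.2)).trans (hp i i.2) (pe j j.2).symm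
  · rw [← Finset.sum_range]
    have := equiv_sum n hp po (fun i _ => he i) eo pe
    rw [es] at this
    exact hfin _ (proj_sum n hp po) this.symm (by simp [ProjLE])

end Masa

/-- In an AW*-algebra of type II₁, any maximal abelian subalgebra contains `n`
pairwise orthogonal, pairwise equivalent projections with sum `1`. -/
theorem typeIIone_masa_equivalent_projections {A : Type u} [NormedRing A] [StarRing A]
    [CStarRing A] [NormedAlgebra ℂ A] [StarModule ℂ A] [CompleteSpace A]
    (hAW : IsAWStarRing A)
    (hfin : ProjFinite (1 : A))
    (hNoAbelianProj : ∀ e : A, IsAbelianProj e → e = 0)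
    (M : StarSubalgebra ℂ A) (hM : IsMaximalAbelian M)
    (n : ℕ) (hn : 0 < n) :
    ∃ p : Fin n → A, (∀ i, p i ∈ M) ∧ (∀ i, IsProjection (p i)) ∧
      PairwiseOrthogonal p ∧ (∀ i j, ProjEquiv (p i) (p j)) ∧ ∑ i, p i = 1 := by
  letI : CStarAlgebra A := {}
  exact final hAW hNoAbelianProj hfin hM n hn
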